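/- arXiv:2206.09904 — 7 statements merged into one kernel-verified Lean document; each statement's English description precedes it below -/
import Mathlib

section
/- Let R be a commutative ring of prime characteristic p, and let n be a positive integer written as n = p^k·m with p ∤ m (so m is the p-free part of n). Then w_n(R) ≤ w_m(R). If moreover R is reduced (has no nonzero nilpotent elements), then w_n(R) = w_m(R). -/
/-- `a` is a sum of finitely many `n`-th powers in `R`. -/
def IsSumOfPowers (R : Type*) [CommRing R] (n : ℕ) (a : R) : Prop :=
  ∃ l : ℕ, ∃ x : Fin l → R, a = ∑ i, x i ^ n

/-- The `n`-length of `a ∈ R`: the least positive integer `g` such that `a` is a sum of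
`g` `n`-th powers of elements of `R`, or `∞` if no such `g` exists. -/
noncomputable def nLength (R : Type*) [CommRing R] (n : ℕ) (a : R) : ℕ∞ :=
  sInf {g : ℕ∞ | ∃ l : ℕ, g = l ∧ 0 < l ∧ ∃ x : Fin l → R, a = ∑ i, x i ^ n}

/-- The `n`-th level of `R`: `s_n(R) = ℓ_n(-1)`. -/
noncomputable def level (R : Type*) [CommRing R] (n : ℕ) : ℕ∞ :=
  nLength R n (-1)

/-- The `n`-th Waring number of `R`: the least positive integer `g` such that every element of
`R` which is a sum of finitely many `n`-th powers is a sum of at most `g` `n`-th powers,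
or `∞` if no such `g` exists. -/
noncomputable def waring (R : Type*) [CommRing R] (n : ℕ) : ℕ∞ :=
  sInf {g : ℕ∞ | ∃ l : ℕ, g = l ∧ 0 < l ∧
    ∀ a : R, IsSumOfPowers R n a → nLength R n a ≤ l}

/-- `m` is the `p`-free part of `n`: if `p = 0` then `m = n`, and otherwise `n = p ^ j * m`
with `p ∤ m`. -/
def IsFreePart (p n m : ℕ) : Prop :=
  (p = 0 ∧ m = n) ∨ (p ≠ 0 ∧ ¬ p ∣ m ∧ ∃ j : ℕ, n = p ^ j * m)

theorem map_iterateFrobenius_sum_pow {R : Type*} [CommRing R] (p : ℕ) [ExpChar R p]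
    (k m : ℕ) {l : ℕ} (x : Fin l → R) :
    iterateFrobenius R p k (∑ i, x i ^ m) = ∑ i, x i ^ (p ^ k * m) := by
  rw [map_sum]
  refine Finset.sum_congr rfl fun i _ ↦ ?_
  rw [iterateFrobenius_def, ← pow_mul, mul_comm]

theorem nLength_iterateFrobenius_le {R : Type*} [CommRing R] (p : ℕ) [ExpChar R p]
    (k m : ℕ) (b : R) :
    nLength R (p ^ k * m) (iterateFrobenius R p k b) ≤ nLength R m b := by
  refine sInf_le_sInf ?_
  rintro g ⟨l, hg, hl, x, rfl⟩
  exact ⟨l, hg, hl, x, map_iterateFrobenius_sum_pow p k m x⟩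

theorem nLength_iterateFrobenius {R : Type*} [CommRing R] [IsReduced R] (p : ℕ) [ExpChar R p]
    (k m : ℕ) (b : R) :
    nLength R (p ^ k * m) (iterateFrobenius R p k b) = nLength R m b := by
  refine le_antisymm (nLength_iterateFrobenius_le p k m b) (sInf_le_sInf ?_)
  rintro g ⟨l, hg, hl, x, hx⟩
  refine ⟨l, hg, hl, x, iterateFrobenius_inj R p k ?_⟩
  rw [hx, map_iterateFrobenius_sum_pow]

theorem waring_pow_mul_le {R : Type*} [CommRing R] (p : ℕ) [ExpChar R p] (k m : ℕ) :
    waring R (p ^ k * m) ≤ waring R m := by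
  refine sInf_le_sInf ?_
  rintro g ⟨l, hg, hl, h⟩
  refine ⟨l, hg, hl, ?_⟩
  rintro a ⟨t, x, rfl⟩
  rw [← map_iterateFrobenius_sum_pow]
  exact (nLength_iterateFrobenius_le p k m _).trans (h _ ⟨t, x, rfl⟩)

theorem waring_pow_mul {R : Type*} [CommRing R] [IsReduced R] (p : ℕ) [ExpChar R p]
    (k m : ℕ) : waring R (p ^ k * m) = waring R m := by
  refine le_antisymm (waring_pow_mul_le p k m) (sInf_le_sInf ?_)
  rintro g ⟨l, hg, hl, h⟩
  refine ⟨l, hg, hl, ?_⟩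
  rintro b ⟨t, x, rfl⟩
  rw [← nLength_iterateFrobenius p k]
  exact h _ ⟨t, x, map_iterateFrobenius_sum_pow p k m x⟩

/-- If `R` is a commutative ring of prime characteristic `p` and `n = p^k * m`
with `p ∤ m` is a positive integer, then `w_n(R) ≤ w_m(R)`; if moreover `R` is reduced then
`w_n(R) = w_m(R)`. -/
theorem waring_free_part_of_charP (R : Type*) [CommRing R] (p : ℕ) (hp : p.Prime)
    [CharP R p] (n m k : ℕ) (hn : 0 < n) (hdecomp : n = p ^ k * m) (hpm : ¬ p ∣ m) :
    waring R n ≤ waring R m ∧ (IsReduced R → waring R n = waring R m) := by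
  have : ExpChar R p := .prime hp
  subst hdecomp
  exact ⟨waring_pow_mul_le p k m, fun _ ↦ waring_pow_mul p k m⟩
end

section
/- Let R be a henselian local ring with maximal ideal 𝔪 and residue field k = R/𝔪, let n be a positive integer and m the char(k)-free part of n. Assume that char(k) ∤ n, or that char(R) = char(k) and R is reduced. If s_m(k) < ∞, then s_n(R) = s_m(k) and w_n(R) ≤ max{w_m(k), s_m(k)+1}. -/
theorem nLength_congr {R S : Type*} [CommRing R] [CommRing S] {n m : ℕ} {a : R} {b : S}
    (h : ∀ l : ℕ, (∃ x : Fin l → R, a = ∑ i, x i ^ n) ↔ ∃ y : Fin l → S, b = ∑ i, y i ^ m) :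
    nLength R n a = nLength S m b := by
  simp only [nLength, h]

theorem nLength_le_of_eq_sum {R : Type*} [CommRing R] {n l : ℕ} {a : R} (hl : 0 < l)
    (x : Fin l → R) (h : a = ∑ i, x i ^ n) : nLength R n a ≤ l :=
  sInf_le ⟨l, rfl, hl, x, h⟩

theorem exists_eq_sum_of_nLength_lt_top {R : Type*} [CommRing R] {n : ℕ} {a : R}
    (h : nLength R n a < ⊤) :
    ∃ l : ℕ, nLength R n a = l ∧ 0 < l ∧ ∃ x : Fin l → R, a = ∑ i, x i ^ n := by
  refine csInf_mem (s := {g : ℕ∞ | ∃ l : ℕ, g = l ∧ 0 < l ∧ ∃ x : Fin l → R, a = ∑ i, x i ^ n})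
    (Set.nonempty_iff_ne_empty.2 fun he ↦ ?_)
  rw [nLength, he, sInf_empty] at h
  exact lt_irrefl _ h

theorem exists_nat_eq_waring {R : Type*} [CommRing R] {n : ℕ} (h : waring R n < ⊤) :
    ∃ l : ℕ, waring R n = l ∧ 0 < l ∧ ∀ a : R, IsSumOfPowers R n a → nLength R n a ≤ l := by
  refine csInf_mem (s := {g : ℕ∞ | ∃ l : ℕ, g = l ∧ 0 < l ∧
    ∀ a : R, IsSumOfPowers R n a → nLength R n a ≤ l})
    (Set.nonempty_iff_ne_empty.2 fun he ↦ ?_)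
  rw [waring, he, sInf_empty] at h
  exact lt_irrefl _ h

section Frobenius

variable {R : Type*} [CommRing R] [IsReduced R] (p j m : ℕ) [ExpChar R p]

theorem pow_expChar_pow_eq_sum_iff {l : ℕ} (b : R) (x : Fin l → R) :
    b ^ p ^ j = ∑ i, x i ^ (p ^ j * m) ↔ b = ∑ i, x i ^ m := by
  have h : ∑ i, x i ^ (p ^ j * m) = (∑ i, x i ^ m) ^ p ^ j := by
    rw [sum_pow_char_pow]
    exact Finset.sum_congr rfl fun i _ ↦ by rw [mul_comm, pow_mul]
  rw [h]
  exact (iterateFrobenius_inj R p j).eq_iff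

theorem nLength_pow_expChar_pow (b : R) :
    nLength R (p ^ j * m) (b ^ p ^ j) = nLength R m b :=
  nLength_congr fun _ ↦ exists_congr fun x ↦ pow_expChar_pow_eq_sum_iff p j m b x

theorem level_expChar_pow_mul : level R (p ^ j * m) = level R m := by
  have h : (-1 : R) ^ p ^ j = -1 := by
    have := map_neg (iterateFrobenius R p j) 1
    rwa [map_one, iterateFrobenius_def] at this
  rw [level, level, ← nLength_pow_expChar_pow p j m, h]

theorem waring_expChar_pow_mul_le : waring R (p ^ j * m) ≤ waring R m := by
  refine sInf_le_sInf ?_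
  rintro g ⟨l, rfl, hl, H⟩
  refine ⟨l, rfl, hl, ?_⟩
  rintro a ⟨r, x, rfl⟩
  rw [← (pow_expChar_pow_eq_sum_iff p j m _ x).2 rfl, nLength_pow_expChar_pow]
  exact H _ ⟨r, x, rfl⟩

end Frobenius

section Henselian

open IsLocalRing

variable {R : Type*} [CommRing R] [HenselianLocalRing R] {m : ℕ}

theorem HenselianLocalRing.exists_pow_eq (hm : (m : ResidueField R) ≠ 0) {c : R}
    {y : ResidueField R} (hy : y ≠ 0) (h : y ^ m = residue R c) : ∃ x : R, x ^ m = c := by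
  have hm0 : m ≠ 0 := by rintro rfl; simp at hm
  obtain ⟨b, rfl⟩ := residue_surjective y
  obtain ⟨x, hx, -⟩ := HenselianLocalRing.is_henselian (Polynomial.X ^ m - Polynomial.C c)
    (Polynomial.monic_X_pow_sub_C c hm0) b
    (by rw [← residue_eq_zero_iff]; simp [h])
    (by
      rw [← residue_ne_zero_iff_isUnit]
      simp [Polynomial.derivative_X_pow, hm, hy])
  exact ⟨x, by simpa [Polynomial.IsRoot, sub_eq_zero] using hx⟩

theorem HenselianLocalRing.exists_eq_sum_pow (hm : (m : ResidueField R) ≠ 0) {l : ℕ} {a : R}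
    {y : Fin l → ResidueField R} (h : residue R a = ∑ i, y i ^ m) {i : Fin l} (hi : y i ≠ 0) :
    ∃ x : Fin l → R, a = ∑ i, x i ^ m := by
  choose z hz using fun i ↦ residue_surjective (y i)
  obtain ⟨t, ht⟩ := HenselianLocalRing.exists_pow_eq (c := a - ∑ j ∈ {i}ᶜ, z j ^ m) hm hi (by
    simp only [map_sub, h, map_sum, map_pow, hz, Fintype.sum_eq_add_sum_compl i]
    ring)
  refine ⟨Function.update z i t, ?_⟩
  have hs : ∑ j ∈ {i}ᶜ, Function.update z i t j ^ m = ∑ j ∈ {i}ᶜ, z j ^ m :=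
    Finset.sum_congr rfl fun j hj ↦ by
      rw [Function.update_of_ne (by simpa using hj)]
  rw [Fintype.sum_eq_add_sum_compl i, hs, Function.update_self, ht]
  ring

theorem HenselianLocalRing.exists_eq_sum_pow_iff (hm : (m : ResidueField R) ≠ 0) {l : ℕ} {a : R}
    (ha : residue R a ≠ 0) :
    (∃ x : Fin l → R, a = ∑ i, x i ^ m) ↔
      ∃ y : Fin l → ResidueField R, residue R a = ∑ i, y i ^ m := by
  have hm0 : m ≠ 0 := by rintro rfl; simp at hm
  constructor
  · rintro ⟨x, rfl⟩
    exact ⟨fun i ↦ residue R (x i), by simp⟩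
  · rintro ⟨y, hy⟩
    obtain ⟨i, -, hi⟩ := Finset.exists_ne_zero_of_sum_ne_zero (hy ▸ ha)
    exact exists_eq_sum_pow hm hy ((pow_ne_zero_iff hm0).1 hi)

theorem HenselianLocalRing.nLength_residue (hm : (m : ResidueField R) ≠ 0) {a : R}
    (ha : residue R a ≠ 0) : nLength R m a = nLength (ResidueField R) m (residue R a) :=
  nLength_congr fun _ ↦ exists_eq_sum_pow_iff hm ha

theorem HenselianLocalRing.level_eq (hm : (m : ResidueField R) ≠ 0) :
    level R m = level (ResidueField R) m := by
  rw [level, nLength_residue hm (by simp), map_neg, map_one, level]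

theorem HenselianLocalRing.nLength_le_level_add_one (hm : (m : ResidueField R) ≠ 0) {a : R}
    (ha : residue R a = 0) : nLength R m a ≤ level (ResidueField R) m + 1 := by
  rcases eq_or_ne (level (ResidueField R) m) ⊤ with htop | htop
  · simp [htop]
  obtain ⟨s, hs, -, y, hy⟩ := exists_eq_sum_of_nLength_lt_top (lt_top_iff_ne_top.2 htop)
  obtain ⟨x, hx⟩ := exists_eq_sum_pow (a := a) (y := Fin.cons 1 y) hm
    (by simp [Fin.sum_univ_succ, ← hy, ha]) (i := 0) (by simp)
  rw [level, hs]
  exact_mod_cast nLength_le_of_eq_sum s.succ_pos x hx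

theorem HenselianLocalRing.waring_le (hm : (m : ResidueField R) ≠ 0)
    (hlev : level (ResidueField R) m < ⊤) :
    waring R m ≤ max (waring (ResidueField R) m) (level (ResidueField R) m + 1) := by
  rcases eq_or_ne (waring (ResidueField R) m) ⊤ with htop | htop
  · simp [htop]
  obtain ⟨w, hw, hw0, H⟩ := exists_nat_eq_waring (lt_top_iff_ne_top.2 htop)
  obtain ⟨s, hs⟩ := ENat.ne_top_iff_exists.1 hlev.ne
  have hmax : ((max w (s + 1) : ℕ) : ℕ∞) = max (w : ℕ∞) (s + 1) := by
    rw [Nat.mono_cast.map_max, Nat.cast_succ]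
  refine sInf_le ⟨max w (s + 1), by rw [hw, ← hs, hmax], by omega, ?_⟩
  rintro a ⟨l, x, rfl⟩
  rw [hmax]
  by_cases ha : residue R (∑ i, x i ^ m) = 0
  · exact (hs ▸ nLength_le_level_add_one hm ha).trans (le_max_right _ _)
  · rw [nLength_residue hm ha]
    exact (H _ ⟨l, fun i ↦ residue R (x i), by simp⟩).trans (le_max_left _ _)

end Henselian

/-- Let `R` be a henselian local ring with residue field `k`, `n` a positive
integer and `m` the `char(k)`-free part of `n`. Assume `char(k) ∤ n`, or `char(R) = char(k)`
and `R` is reduced. If `s_m(k) < ∞`, then `s_n(R) = s_m(k)` and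
`w_n(R) ≤ max {w_m(k), s_m(k) + 1}`. -/
theorem level_and_waring_of_henselianLocalRing (R : Type*) [CommRing R]
    [HenselianLocalRing R] (n m : ℕ) (hn : 0 < n)
    (hm : IsFreePart (ringChar (IsLocalRing.ResidueField R)) n m)
    (hchar : ¬ ringChar (IsLocalRing.ResidueField R) ∣ n ∨
      (ringChar R = ringChar (IsLocalRing.ResidueField R) ∧ IsReduced R))
    (hlev : level (IsLocalRing.ResidueField R) m < ⊤) :
    level R n = level (IsLocalRing.ResidueField R) m ∧
      waring R n ≤ max (waring (IsLocalRing.ResidueField R) m)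
        (level (IsLocalRing.ResidueField R) m + 1) := by
  set p := ringChar (IsLocalRing.ResidueField R) with hp
  rcases hm with ⟨hp0, rfl⟩ | ⟨hp0, hpm, j, rfl⟩
  · have hm : (m : IsLocalRing.ResidueField R) ≠ 0 := fun h ↦ by
      rw [ringChar.spec, ← hp, hp0, zero_dvd_iff] at h
      exact hn.ne' h
    exact ⟨HenselianLocalRing.level_eq hm, HenselianLocalRing.waring_le hm hlev⟩
  · have hm : (m : IsLocalRing.ResidueField R) ≠ 0 := fun h ↦ hpm ((ringChar.spec _ _).1 h)
    rcases hchar with hpn | ⟨hR, hred⟩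
    · obtain rfl : j = 0 := by
        by_contra hj
        exact hpn ((dvd_pow_self p hj).mul_right m)
      rw [pow_zero, one_mul]
      exact ⟨HenselianLocalRing.level_eq hm, HenselianLocalRing.waring_le hm hlev⟩
    · have hprime : p.Prime :=
        (CharP.char_is_prime_or_zero (IsLocalRing.ResidueField R) p).resolve_right hp0
      have : CharP R p := ringChar.of_eq hR
      have : ExpChar R p := .prime hprime
      exact ⟨(level_expChar_pow_mul p j m).trans (HenselianLocalRing.level_eq hm),
        (waring_expChar_pow_mul_le p j m).trans (HenselianLocalRing.waring_le hm hlev)⟩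
end

section
/- Let K be a field with a nontrivial rank-1 valuation ν : K → ℝ ∪ {∞}, let R = {f ∈ K : ν(f) ≥ 0}, 𝔪 = {f ∈ K : ν(f) > 0}, and k = R/𝔪. Let n be a positive integer and m the char(k)-free part of n. Then s_n(R) = s_n(K) ≥ s_m(k), and both are equal to s_m(k) if R is henselian and either char(k) ∤ n or char(R) = char(k). -/
theorem level_le_level {A B : Type*} [CommRing A] [CommRing B] {a b : ℕ}
    (h : ∀ l : ℕ, 0 < l → ∀ x : Fin l → A, -1 = ∑ i, x i ^ a →
      ∃ y : Fin l → B, -1 = ∑ i, y i ^ b) :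
    level B b ≤ level A a := by
  refine sInf_le_sInf ?_
  rintro g ⟨l, rfl, hl, x, hx⟩
  exact ⟨l, rfl, hl, h l hl x hx⟩

theorem level_le_level_of_ringHom {A B : Type*} [CommRing A] [CommRing B] (f : A →+* B) (n : ℕ) :
    level B n ≤ level A n := by
  refine level_le_level fun l _ x hx => ⟨fun i => f (x i), ?_⟩
  simpa using congrArg f hx

theorem level_le_level_mul (A : Type*) [CommRing A] (m k : ℕ) :
    level A m ≤ level A (k * m) := by
  refine level_le_level fun l _ x hx => ⟨fun i => x i ^ k, ?_⟩
  simpa [pow_mul] using hx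

theorem level_charP_pow_mul_le (A : Type*) [CommRing A] (p : ℕ) [Fact p.Prime] [CharP A p]
    (m j : ℕ) : level A (p ^ j * m) ≤ level A m := by
  refine level_le_level fun l _ x hx => ⟨x, ?_⟩
  have h := congrArg (· ^ p ^ j) hx
  simp only [sum_pow_char_pow, ← pow_mul] at h
  have h1 : (-1 : A) ^ p ^ j = -1 := by
    have := map_neg (iterateFrobenius A p j) 1
    simpa [iterateFrobenius_def] using this
  rw [h1] at h
  simpa only [mul_comm] using h

/-- Sums of powers equal to `-1` lift along a henselian pair `(R, I)` with `I` maximal when the exponent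
is invertible in the residue field. -/
theorem level_le_level_quotient_of_henselian {R : Type*} [CommRing R] (I : Ideal R) [I.IsMaximal]
    [HenselianRing R I] {n : ℕ} (hn : ((n : ℕ) : R ⧸ I) ≠ 0) :
    level R n ≤ level (R ⧸ I) n := by
  let := Ideal.Quotient.field I
  have hn0 : n ≠ 0 := by rintro rfl; simp at hn
  refine level_le_level fun l _ x hx => ?_
  obtain ⟨y, hy⟩ : ∃ y : Fin l → R, ∀ i, Ideal.Quotient.mk I (y i) = x i :=
    ⟨fun i => (Ideal.Quotient.mk_surjective (x i)).choose,
      fun i => (Ideal.Quotient.mk_surjective (x i)).choose_spec⟩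
  obtain ⟨i₀, hi₀⟩ : ∃ i, x i ≠ 0 := by
    by_contra! h
    simp [h, hn0] at hx
  set c : R := ∑ i ∈ Finset.univ.erase i₀, y i ^ n + 1 with hc
  have hroot : (Polynomial.X ^ n + Polynomial.C c).eval (y i₀) ∈ I := by
    rw [← Ideal.Quotient.eq_zero_iff_mem]
    simp only [Polynomial.eval_add, Polynomial.eval_pow, Polynomial.eval_X, Polynomial.eval_C]
    simp only [hc, map_add, map_sum, map_pow, map_one, hy]
    rw [← add_assoc, Finset.add_sum_erase _ (fun i => x i ^ n) (Finset.mem_univ i₀), ← hx]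
    simp
  have hderiv : IsUnit (Ideal.Quotient.mk I
      ((Polynomial.X ^ n + Polynomial.C c).derivative.eval (y i₀))) := by
    rw [isUnit_iff_ne_zero]
    simp [Polynomial.derivative_X_pow, hy, hn, hi₀]
  obtain ⟨a, ha, -⟩ := HenselianRing.is_henselian (I := I) _
    (Polynomial.monic_X_pow_add_C c hn0) (y i₀) hroot hderiv
  refine ⟨Function.update y i₀ a, ?_⟩
  rw [← Finset.add_sum_erase _ _ (Finset.mem_univ i₀), Finset.sum_congr rfl
    (g := fun i => y i ^ n) fun i hi => by rw [Function.update_of_ne (Finset.ne_of_mem_erase hi)]]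
  simp only [Polynomial.IsRoot.def, Polynomial.eval_add, Polynomial.eval_pow, Polynomial.eval_X,
    Polynomial.eval_C, hc] at ha
  rw [Function.update_self]
  linear_combination -ha

/-- The level of a valuation ring, given through a valuation, is at most that of its field. -/
theorem level_subring_le_level {K : Type*} [Field K] (R : Subring K)
    (hR : ∀ {l : ℕ}, 0 < l → ∀ x : Fin l → K, (∀ i, x i ∈ R) ∨
      ∃ i₀, x i₀ ≠ 0 ∧ (x i₀)⁻¹ ∈ R ∧ ∀ i, x i / x i₀ ∈ R) (n : ℕ) :
    level R n ≤ level K n := by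
  refine level_le_level fun l hl x hx => ?_
  suffices h : ∃ y : Fin l → K, (∀ i, y i ∈ R) ∧ -1 = ∑ i, y i ^ n by
    obtain ⟨y, hy, h⟩ := h
    refine ⟨fun i => ⟨y i, hy i⟩, Subtype.ext ?_⟩
    simpa using h
  obtain h | ⟨i₀, h0, hinv, hdiv⟩ := hR hl x
  · exact ⟨x, h, hx⟩
  · refine ⟨Function.update (fun i => x i / x i₀) i₀ (x i₀)⁻¹, fun i => ?_, ?_⟩
    · by_cases hi : i = i₀
      · subst hi; simpa using hinv
      · simpa [Function.update_of_ne hi] using hdiv i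
    · rw [← Finset.add_sum_erase _ _ (Finset.mem_univ i₀), Finset.sum_congr rfl
        (g := fun i => x i ^ n / x i₀ ^ n) fun i hi => by
          rw [Function.update_of_ne (Finset.ne_of_mem_erase hi), div_pow],
        ← Finset.sum_div, Function.update_self]
      rw [← Finset.add_sum_erase _ _ (Finset.mem_univ i₀)] at hx
      have : x i₀ ^ n ≠ 0 := pow_ne_zero _ h0
      rw [inv_pow]
      field_simp
      linear_combination hx

/-- Let `K` be a field with a nontrivial rank-1 valuation `ν : K → ℝ ∪ {∞}`,
`R = {f : ν f ≥ 0}`, `𝔪 = {f : ν f > 0}`, `k = R/𝔪`, `n` a positive integer and `m` the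
`char(k)`-free part of `n`. Then `s_n(R) = s_n(K) ≥ s_m(k)`, with equalities if `R` is
henselian and either `char(k) ∤ n` or `char(R) = char(k)`. -/
theorem level_of_rank_one_valuation (K : Type*) [Field K] (ν : K → WithTop ℝ)
    (hν0 : ∀ x, ν x = ⊤ ↔ x = 0)
    (hνmul : ∀ x y, ν (x * y) = ν x + ν y)
    (hνadd : ∀ x y, min (ν x) (ν y) ≤ ν (x + y))
    (hνnontriv : ∃ x, ν x ≠ 0 ∧ ν x ≠ ⊤)
    (R : Subring K) (hR : ∀ f : K, f ∈ R ↔ 0 ≤ ν f)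
    (𝔪 : Ideal R) (h𝔪 : ∀ f : R, f ∈ 𝔪 ↔ 0 < ν (f : K))
    (n m : ℕ) (hn : 0 < n)
    (hm : IsFreePart (ringChar (R ⧸ 𝔪)) n m) :
    level R n = level K n ∧ level (R ⧸ 𝔪) m ≤ level K n ∧
      (HenselianRing R 𝔪 →
        (¬ ringChar (R ⧸ 𝔪) ∣ n ∨ ringChar R = ringChar (R ⧸ 𝔪)) →
        level K n = level (R ⧸ 𝔪) m) := by

  have hν1 : ν 1 = 0 := by
    have h := hνmul 1 1
    have h1 : ν 1 ≠ ⊤ := fun h => one_ne_zero ((hν0 1).1 h)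
    rw [mul_one] at h
    lift ν 1 to ℝ using h1 with r
    norm_cast at h ⊢
    linarith
  have hdiv : ∀ x y : K, y ≠ 0 → ν y ≤ ν x → x / y ∈ R := by
    intro x y hy hxy
    rw [hR]
    by_contra! h
    have hy' : ν y ≠ ⊤ := fun h => hy ((hν0 y).1 h)
    have hq : ν (x / y) ≠ ⊤ := h.ne_top
    have hx := hνmul (x / y) y
    rw [div_mul_cancel₀ _ hy] at hx
    rw [hx] at hxy
    lift ν y to ℝ using hy' with r
    lift ν (x / y) to ℝ using hq with s
    norm_cast at h hxy
    linarith
  have hKR : level R n = level K n := by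
    refine le_antisymm (level_subring_le_level R (fun {l} hl x => ?_) n)
      (level_le_level_of_ringHom R.subtype n)
    have : Nonempty (Fin l) := ⟨⟨0, hl⟩⟩
    obtain ⟨i₀, hi₀⟩ := Finite.exists_min fun i => ν (x i)
    by_cases h : 0 ≤ ν (x i₀)
    · exact Or.inl fun i => (hR _).2 (h.trans (hi₀ i))
    · have h0 : x i₀ ≠ 0 := fun h0 => h (by rw [(hν0 _).2 h0]; exact le_top)
      refine Or.inr ⟨i₀, h0, ?_, fun i => hdiv _ _ h0 (hi₀ i)⟩
      rw [← one_div]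
      exact hdiv _ _ h0 (by rw [hν1]; exact (not_le.1 h).le)
  have hmk : level (R ⧸ 𝔪) m ≤ level R n := by
    refine le_trans ?_ (level_le_level_of_ringHom (Ideal.Quotient.mk 𝔪) n)
    obtain ⟨-, rfl⟩ | ⟨-, -, j, rfl⟩ := hm
    · exact le_rfl
    · exact level_le_level_mul _ _ _
  refine ⟨hKR, hKR ▸ hmk, fun hHens hchar => hKR ▸ le_antisymm ?_ hmk⟩
  have hmax : 𝔪.IsMaximal := by
    rw [Ideal.isMaximal_iff]
    refine ⟨fun h => by simpa [hν1] using (h𝔪 1).1 h, fun J x _ hx hxJ => ?_⟩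
    have hx0 : ν (x : K) ≤ 0 := not_lt.1 fun h => hx ((h𝔪 x).2 h)
    have hxne : (x : K) ≠ 0 := fun h0 => by simp [(hν0 _).2 h0] at hx0
    have hinv : 1 / (x : K) ∈ R := hdiv _ _ hxne (hν1 ▸ hx0)
    have h1 : (⟨1 / (x : K), hinv⟩ : R) * x = 1 := Subtype.ext (by simp [hxne])
    exact h1 ▸ J.mul_mem_left _ hxJ
  have hlift : ¬ ringChar (R ⧸ 𝔪) ∣ m → level R m ≤ level (R ⧸ 𝔪) m := fun h =>
    level_le_level_quotient_of_henselian 𝔪 fun h0 => h ((ringChar.spec _ _).1 h0)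
  obtain ⟨h0, rfl⟩ | ⟨h0, hpm, j, hj⟩ := hm
  · exact hlift (by rw [h0, zero_dvd_iff]; exact hn.ne')
  · refine le_trans ?_ (hlift hpm)
    obtain hpn | hRk := hchar
    · have : j = 0 := by
        by_contra hj0
        exact hpn (hj ▸ (dvd_pow_self _ hj0).mul_right m)
      simp [hj, this]
    · have hp : Fact (ringChar (R ⧸ 𝔪)).Prime :=
        ⟨(CharP.char_is_prime_or_zero (R ⧸ 𝔪) _).resolve_right h0⟩
      have : CharP R (ringChar (R ⧸ 𝔪)) := hRk ▸ ringChar.charP R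
      rw [hj]
      exact level_charP_pow_mul_le R _ m j
end

section
/- Let R be a henselian local ring with residue field k whose total ring of fractions Q(R) satisfies Q(R) ≠ R, and let n > 1 be an odd positive integer with char(k) ∤ n. Then every element f ∈ Q(R) can be written as f = f₁ⁿ + f₂ⁿ for some f₁, f₂ ∈ Q(R). -/
/-- In a henselian local ring in which `n` is invertible, every element `1 + m` with `m` in the
maximal ideal is an `n`-th power. -/
theorem HenselianLocalRing.exists_pow_eq_one_add {R : Type*} [CommRing R] [HenselianLocalRing R]
    {n : ℕ} (hn : n ≠ 0) (hu : IsUnit (n : R)) {m : R} (hm : m ∈ IsLocalRing.maximalIdeal R) :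
    ∃ x : R, x ^ n = 1 + m := by
  obtain ⟨x, hx, -⟩ := HenselianLocalRing.is_henselian
    (Polynomial.X ^ n - Polynomial.C (1 + m)) (Polynomial.monic_X_pow_sub_C _ hn) 1
    (by simpa using hm) (by simpa [Polynomial.derivative_X_pow] using hu)
  exact ⟨x, by simpa [sub_eq_zero] using hx⟩

/-- If `b` is a non-zerodivisor in the maximal ideal of a henselian local ring in which the odd
number `n > 1` is invertible, then every fraction `a / b` is a sum of two `n`-th powers. -/
theorem IsLocalization.exists_mk'_eq_pow_add_pow {R : Type*} [CommRing R] [HenselianLocalRing R]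
    {K : Type*} [CommRing K] [Algebra R K] {M : Submonoid R} [IsLocalization M K]
    {n : ℕ} (hn : 1 < n) (hodd : Odd n) (hu : IsUnit (n : R)) (a : R) {b : M}
    (hb : (b : R) ∈ IsLocalRing.maximalIdeal R) :
    ∃ x y : K, IsLocalization.mk' K a b = x ^ n + y ^ n := by
  obtain ⟨x, hx⟩ := HenselianLocalRing.exists_pow_eq_one_add (by lia) hu
    (Ideal.mul_mem_left _ a (Ideal.pow_mem_of_mem _ hb (n - 1) (by lia)))
  refine ⟨IsLocalization.mk' K x b, -IsLocalization.mk' K 1 b, ?_⟩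
  rw [hodd.neg_pow, ← IsLocalization.mk'_pow, ← IsLocalization.mk'_pow, ← sub_eq_add_neg,
    ← IsLocalization.mk'_sub, IsLocalization.mk'_eq_iff_eq]
  congr 1
  obtain ⟨k, rfl⟩ := Nat.exists_eq_add_of_lt hn
  simp only [hx, Submonoid.coe_mul, SubmonoidClass.coe_pow, Nat.add_sub_cancel]
  ring

/-- A local ring that differs from its total ring of fractions has a non-zerodivisor in its
maximal ideal. -/
theorem IsLocalRing.exists_mem_nonZeroDivisors_mem_maximalIdeal {R : Type*} [CommRing R]
    [IsLocalRing R] (hQR : ¬ Function.Surjective (algebraMap R (FractionRing R))) :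
    ∃ t ∈ nonZeroDivisors R, t ∈ IsLocalRing.maximalIdeal R := by
  contrapose! hQR
  exact (IsLocalization.atUnits R (nonZeroDivisors R) (S := FractionRing R) fun t ht ↦ by
    simpa [IsUnit.mem_submonoid_iff] using hQR t ht).surjective

/-- Let `R` be a henselian local ring with residue field `k`, whose total ring
of fractions `Q(R)` satisfies `Q(R) ≠ R`, and let `n > 1` be odd with `char(k) ∤ n`. Then
every `f ∈ Q(R)` is a sum of two `n`-th powers. -/
theorem sum_of_two_powers_in_totalFractionRing (R : Type*) [CommRing R]
    [HenselianLocalRing R]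
    (hQR : ¬ Function.Surjective (algebraMap R (FractionRing R)))
    (n : ℕ) (hn : 1 < n) (hodd : Odd n)
    (hchar : ¬ ringChar (IsLocalRing.ResidueField R) ∣ n) :
    ∀ f : FractionRing R, ∃ f₁ f₂ : FractionRing R, f = f₁ ^ n + f₂ ^ n := by
  obtain ⟨t, ht, htm⟩ := IsLocalRing.exists_mem_nonZeroDivisors_mem_maximalIdeal hQR
  have hu : IsUnit (n : R) := by
    rw [← IsLocalRing.residue_ne_zero_iff_isUnit, map_natCast]
    rwa [← ringChar.spec] at hchar
  intro f
  obtain ⟨a, b, rfl⟩ := IsLocalization.exists_mk'_eq (nonZeroDivisors R) f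
  obtain ⟨x, y, h⟩ := IsLocalization.exists_mk'_eq_pow_add_pow (K := FractionRing R) hn hodd hu
    (a * t) (b := b * ⟨t, ht⟩) (Ideal.mul_mem_left _ _ htm)
  exact ⟨x, y, by rwa [← IsLocalization.mk'_cancel a b ⟨t, ht⟩]⟩
end

section
/- Let k be a field and n a positive integer such that s_n(k) = ∞. Then w_n(k((x₁))…((x_{s-1}))[[x_s]]) = w_n(k((x₁))…((x_s))) = w_n(k), and w_n(k[[x₁,…,x_s]]) ≥ w_n(k((x₁,…,x_s))) ≥ w_n(k), where k[[x₁,…,x_s]] is the ring of formal power series in s variables, k((x₁,…,x_s)) its field of fractions, and k((x₁))…((x_s)) the s-fold iterated Laurent series field over k. -/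
/-- Auxiliary construction: the `s`-fold iterated Laurent series field over `k`,
bundled with its field structure. -/
noncomputable def IterLaurentAux (k : Type) [Field k] : ℕ → (T : Type) × Field T
  | 0 => ⟨k, ‹Field k›⟩
  | s + 1 =>
      let prev := IterLaurentAux k s
      letI := prev.2
      ⟨LaurentSeries prev.1, inferInstance⟩

/-- The `s`-fold iterated Laurent series field `k((x₁))…((x_s))` over `k`. -/
def IterLaurent (k : Type) [Field k] (s : ℕ) : Type := (IterLaurentAux k s).1

noncomputable instance IterLaurent.instField (k : Type) [Field k] (s : ℕ) :
    Field (IterLaurent k s) := (IterLaurentAux k s).2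

theorem IterLaurent_zero (k : Type) [Field k] : IterLaurent k 0 = k := rfl

theorem IterLaurent_succ (k : Type) [Field k] (s : ℕ) :
    IterLaurent k (s + 1) = LaurentSeries (IterLaurent k s) := rfl

theorem exists_nLength_witness {R : Type*} [CommRing R] {n l : ℕ} {a : R} (hn : 0 < n)
    (h : nLength R n a ≤ l) : ∃ x : Fin l → R, a = ∑ i, x i ^ n := by
  have hne : {g : ℕ∞ | ∃ l : ℕ, g = l ∧ 0 < l ∧
      ∃ x : Fin l → R, a = ∑ i, x i ^ n}.Nonempty := by
    by_contra hempty
    rw [Set.not_nonempty_iff_eq_empty] at hempty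
    simp [nLength, hempty] at h
  obtain ⟨m, hm, -, x, hx⟩ := csInf_mem hne
  have hml : m ≤ l := by
    have hm' : nLength R n a = m := hm
    rw [hm'] at h
    exact_mod_cast h
  obtain ⟨e, rfl⟩ := Nat.exists_eq_add_of_le hml
  refine ⟨Fin.append x 0, ?_⟩
  simp [Fin.sum_univ_add, hx, zero_pow hn.ne']

theorem nLength_le_of_sum {R : Type*} [CommRing R] {n l : ℕ} {a : R} (hl : 0 < l)
    (x : Fin l → R) (hx : a = ∑ i, x i ^ n) : nLength R n a ≤ l :=
  sInf_le ⟨l, rfl, hl, x, hx⟩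

/-- A bound on the number of `n`-th powers needed that transfers from `R` to `S` bounds the
Waring number of `S` by that of `R`. -/
theorem waring_le_waring {R S : Type*} [CommRing R] [CommRing S] {n : ℕ} (hn : 0 < n)
    (h : ∀ l : ℕ, (∀ a : R, IsSumOfPowers R n a → ∃ x : Fin l → R, a = ∑ i, x i ^ n) →
      ∀ a : S, IsSumOfPowers S n a → ∃ x : Fin l → S, a = ∑ i, x i ^ n) :
    waring S n ≤ waring R n := by
  refine le_sInf ?_
  rintro _ ⟨l, rfl, hl, hR⟩
  refine sInf_le ⟨l, rfl, hl, fun a ha => ?_⟩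
  obtain ⟨x, hx⟩ := h l (fun b hb => exists_nLength_witness hn (hR b hb)) a ha
  exact nLength_le_of_sum hl x hx

theorem level_eq_top_iff {R : Type*} [CommRing R] {n : ℕ} :
    level R n = ⊤ ↔ ∀ l : ℕ, 0 < l → ∀ x : Fin l → R, -1 ≠ ∑ i, x i ^ n := by
  constructor
  · intro h l hl x hx
    have := nLength_le_of_sum hl x hx
    rw [← level, h] at this
    simp at this
  · intro h
    refine sInf_eq_top.2 ?_
    rintro _ ⟨l, rfl, hl, x, hx⟩
    exact (h l hl x hx).elim

section Field

variable {K : Type*} [Field K] {n : ℕ}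

theorem eq_zero_of_sum_pow_eq_zero (hn : 0 < n) (hK : level K n = ⊤) {l : ℕ}
    {y : Fin l → K} (hy : ∑ i, y i ^ n = 0) (j : Fin l) : y j = 0 := by
  by_contra hj
  refine level_eq_top_iff.1 hK l j.pos (fun i => if i = j then 0 else y i / y j) ?_
  have hsum : ∑ i, (if i = j then 0 else y i / y j) ^ n + 1 = 0 := by
    calc
      _ = ∑ i, ((if i = j then 0 else y i / y j) ^ n + if i = j then 1 else 0) := by
        simp [Finset.sum_add_distrib]
      _ = ∑ i, y i ^ n / y j ^ n := by
        refine Finset.sum_congr rfl fun i _ => ?_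
        by_cases h : i = j
        · simp [h, hn.ne', div_self (pow_ne_zero n hj)]
        · simp [h, div_pow]
      _ = 0 := by rw [← Finset.sum_div, hy, zero_div]
  exact (eq_neg_of_add_eq_zero_left hsum).symm

theorem natCast_ne_zero_of_level_eq_top (hn : 0 < n) (hK : level K n = ⊤) : (n : K) ≠ 0 := by
  intro h
  have := eq_zero_of_sum_pow_eq_zero (l := n) (y := fun _ => (1 : K)) hn hK (by simp [h])
    ⟨0, hn⟩
  exact one_ne_zero this

end Field

namespace MvPowerSeries

variable {σ K : Type*} [LinearOrder σ] [WellFoundedGT σ]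

theorem coeff_add_mul_of_le_lexOrder [Semiring K] {φ ψ : MvPowerSeries σ K} {p q : σ →₀ ℕ}
    (hp : toLex p ≤ lexOrder φ) (hq : toLex q ≤ lexOrder ψ) :
    coeff (p + q) (φ * ψ) = coeff p φ * coeff q ψ := by
  rw [coeff_mul, Finset.sum_eq_single_of_mem ⟨p, q⟩ (by simp)]
  rintro ⟨u, v⟩ h h'
  rw [Finset.HasAntidiagonal.mem_antidiagonal] at h
  rcases trichotomy_of_add_eq_add (congrArg toLex h) with h'' | h'' | h''
  · exact (h' (Prod.ext h''.1 h''.2)).elim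
  · rw [coeff_eq_zero_of_lt_lexOrder (d := u) (lt_of_lt_of_le (by exact_mod_cast h'') hp),
      zero_mul]
  · rw [coeff_eq_zero_of_lt_lexOrder (d := v) (lt_of_lt_of_le (by exact_mod_cast h'') hq),
      mul_zero]

theorem le_lexOrder_pow [Semiring K] {φ : MvPowerSeries σ K} {d : σ →₀ ℕ}
    (hd : toLex d ≤ lexOrder φ) (n : ℕ) :
    toLex (n • d) ≤ lexOrder (φ ^ n) := by
  induction n with
  | zero =>
    rw [zero_smul, le_lexOrder_iff]
    intro e he
    exact absurd (WithTop.coe_lt_coe.1 he) (not_lt.2 bot_le)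
  | succ n ih =>
    rw [succ_nsmul, pow_succ, toLex_add, WithTop.coe_add]
    exact (add_le_add ih hd).trans (le_lexOrder_mul _ _)

theorem coeff_nsmul_pow_of_le_lexOrder [Semiring K] {φ : MvPowerSeries σ K} {d : σ →₀ ℕ}
    (hd : toLex d ≤ lexOrder φ) (n : ℕ) : coeff (n • d) (φ ^ n) = coeff d φ ^ n := by
  induction n with
  | zero => simp
  | succ n ih =>
    rw [succ_nsmul, pow_succ, coeff_add_mul_of_le_lexOrder (le_lexOrder_pow hd n) hd, ih, pow_succ]

variable [Field K] {n : ℕ}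

/-- If `-1` is not a sum of `n`-th powers in `K`, lexicographically leading terms do not cancel in
sums of `n`-th powers of power series over `K`. -/
theorem exists_lexOrder_sum_pow (hn : 0 < n) (hK : level K n = ⊤) {l : ℕ}
    {f : Fin l → MvPowerSeries σ K} (hf : ∃ i, f i ≠ 0) :
    ∃ d : σ →₀ ℕ, (∀ i, toLex d ≤ lexOrder (f i)) ∧
      lexOrder (∑ i, f i ^ n) = toLex (n • d) := by
  obtain ⟨i₀, hi₀⟩ := hf
  obtain ⟨j, -, hj⟩ := Finset.exists_min_image Finset.univ (fun i => lexOrder (f i))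
    ⟨i₀, Finset.mem_univ _⟩
  have hj0 : f j ≠ 0 := by
    intro h
    have := hj i₀ (Finset.mem_univ _)
    rw [h, lexOrder_zero, top_le_iff, lexOrder_eq_top_iff_eq_zero] at this
    exact hi₀ this
  obtain ⟨d, hd⟩ := exists_finsupp_eq_lexOrder_of_ne_zero hj0
  have hle : ∀ i, toLex d ≤ lexOrder (f i) := fun i => hd ▸ hj i (Finset.mem_univ _)
  refine ⟨d, hle, le_antisymm (lexOrder_le_of_coeff_ne_zero ?_) (le_lexOrder_iff.2 ?_)⟩
  · rw [map_sum]
    intro h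
    rw [Finset.sum_congr rfl fun i _ => coeff_nsmul_pow_of_le_lexOrder (hle i) n] at h
    exact coeff_ne_zero_of_lexOrder hd.symm (eq_zero_of_sum_pow_eq_zero hn hK h j)
  · intro e he
    rw [map_sum]
    exact Finset.sum_eq_zero fun i _ =>
      coeff_eq_zero_of_lt_lexOrder (he.trans_le (le_lexOrder_pow (hle i) n))

theorem exists_sum_pow_of_C_mul_pow_eq (hn : 0 < n) (hK : level K n = ⊤) {l : ℕ} {c : K}
    {g : MvPowerSeries σ K} (hg : g ≠ 0) {f : Fin l → MvPowerSeries σ K}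
    (h : C c * g ^ n = ∑ i, f i ^ n) : ∃ y : Fin l → K, c = ∑ i, y i ^ n := by
  by_cases hc : c = 0
  · exact ⟨0, by simp [hc, hn.ne']⟩
  have hf : ∃ i, f i ≠ 0 := by
    by_contra! hf
    have hz : C c * g ^ n = 0 := by simp [h, hf, hn.ne']
    rcases mul_eq_zero.1 hz with hz | hz
    · refine hc ?_
      simpa using congrArg constantCoeff hz
    · exact hg (pow_eq_zero_iff hn.ne' |>.1 hz)
  obtain ⟨d, hd, hsum⟩ := exists_lexOrder_sum_pow hn hK hf
  obtain ⟨e, he⟩ := exists_finsupp_eq_lexOrder_of_ne_zero hg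
  have hge : coeff e g ≠ 0 := coeff_ne_zero_of_lexOrder he.symm
  have hlex : lexOrder (C c * g ^ n) = toLex (n • e) := by
    refine le_antisymm (lexOrder_le_of_coeff_ne_zero ?_) (le_lexOrder_iff.2 fun u hu => ?_)
    · rw [coeff_C_mul, coeff_nsmul_pow_of_le_lexOrder he.ge]
      exact mul_ne_zero hc (pow_ne_zero n hge)
    · rw [coeff_C_mul, coeff_eq_zero_of_lt_lexOrder (hu.trans_le (le_lexOrder_pow he.ge n)),
        mul_zero]
  rw [h, hsum] at hlex
  have hde : n • d = n • e := toLex.injective (WithTop.coe_injective hlex)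
  obtain rfl : d = e := by
    ext s
    have := DFunLike.congr_fun hde s
    simpa [hn.ne'] using this
  have hcoeff := congrArg (coeff (n • d)) h
  rw [coeff_C_mul, coeff_nsmul_pow_of_le_lexOrder he.ge, map_sum] at hcoeff
  rw [Finset.sum_congr rfl fun i _ => coeff_nsmul_pow_of_le_lexOrder (hd i) n] at hcoeff
  refine ⟨fun i => coeff d (f i) / coeff d g, ?_⟩
  simp_rw [div_pow]
  rw [← Finset.sum_div, ← hcoeff, mul_div_cancel_right₀ _ (pow_ne_zero n hge)]

variable {F : Type*} [Field F] [Algebra (MvPowerSeries σ K) F]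

theorem exists_sum_pow_of_algebraMap_C_eq [IsFractionRing (MvPowerSeries σ K) F] (hn : 0 < n)
    (hK : level K n = ⊤) {l : ℕ} {c : K}
    {x : Fin l → F} (h : algebraMap (MvPowerSeries σ K) F (C c) = ∑ i, x i ^ n) :
    ∃ y : Fin l → K, c = ∑ i, y i ^ n := by
  obtain ⟨g, hg⟩ := IsLocalization.exist_integer_multiples_of_finite
    (nonZeroDivisors (MvPowerSeries σ K)) x
  choose f hf using hg
  refine exists_sum_pow_of_C_mul_pow_eq hn hK (nonZeroDivisors.coe_ne_zero g) (f := f) ?_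
  apply IsFractionRing.injective (MvPowerSeries σ K) F
  simp only [map_mul, map_pow, map_sum, h, hf, Algebra.smul_def, mul_pow]
  rw [← Finset.mul_sum, mul_comm]

variable (σ K F) in
theorem level_fractionField_eq_top [IsFractionRing (MvPowerSeries σ K) F] (hn : 0 < n)
    (hK : level K n = ⊤) : level F n = ⊤ := by
  refine level_eq_top_iff.2 fun l hl x hx => ?_
  obtain ⟨y, hy⟩ := exists_sum_pow_of_algebraMap_C_eq (σ := σ) (c := (-1 : K)) hn hK
    (x := x) (by simpa using hx)
  exact level_eq_top_iff.1 hK l hl y hy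

variable (σ K F) in
theorem waring_le_waring_fractionField [IsFractionRing (MvPowerSeries σ K) F] (hn : 0 < n)
    (hK : level K n = ⊤) :
    waring K n ≤ waring F n := by
  refine waring_le_waring hn fun l hl c ⟨m, y, hy⟩ => ?_
  obtain ⟨x, hx⟩ := hl (algebraMap (MvPowerSeries σ K) F (C c))
    ⟨m, fun i => algebraMap (MvPowerSeries σ K) F (C (y i)), by simp [hy]⟩
  exact exists_sum_pow_of_algebraMap_C_eq hn hK hx

end MvPowerSeries

theorem waring_fractionRing_le {R F : Type*} [CommRing R] [IsDomain R] [Field F] [Algebra R F]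
    [IsFractionRing R F] {n : ℕ} (hn : 0 < n) : waring F n ≤ waring R n := by
  refine waring_le_waring hn fun l hl a ⟨m, x, hx⟩ => ?_
  obtain ⟨g, hg⟩ := IsLocalization.exist_integer_multiples_of_finite (nonZeroDivisors R) x
  choose f hf using hg
  obtain ⟨y, hy⟩ := hl (∑ i, f i ^ n) ⟨m, f, rfl⟩
  have hg0 : algebraMap R F g ≠ 0 :=
    IsFractionRing.to_map_ne_zero_of_mem_nonZeroDivisors g.2
  refine ⟨fun i => algebraMap R F (y i) / algebraMap R F g, ?_⟩
  have key := congrArg (algebraMap R F) hy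
  simp only [map_pow, map_sum, hf, Algebra.smul_def, mul_pow] at key
  rw [← Finset.mul_sum, ← hx] at key
  simp_rw [div_pow]
  rw [← Finset.sum_div, ← key, mul_div_cancel_left₀ _ (pow_ne_zero n hg0)]

namespace PowerSeries

variable {K : Type*} [Field K] {n : ℕ}

theorem exists_pow_eq_of_constantCoeff_eq_one (hn : 0 < n) (hnK : (n : K) ≠ 0) {u : PowerSeries K}
    (hu : constantCoeff u = 1) : ∃ v : PowerSeries K, v ^ n = u := by
  have hunit : IsUnit (n : PowerSeries K) := by
    rw [isUnit_iff_constantCoeff]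
    simpa using hnK
  obtain ⟨v, hv, -⟩ := HenselianRing.is_henselian (I := Ideal.span {(X : PowerSeries K)})
    (Polynomial.X ^ n - Polynomial.C u) (Polynomial.monic_X_pow_sub_C u hn.ne') 1
    (by
      rw [Ideal.mem_span_singleton, X_dvd_iff]
      simp [hu])
    (by
      refine IsUnit.map _ ?_
      simpa [Polynomial.derivative_X_pow] using hunit)
  refine ⟨v, ?_⟩
  simpa [sub_eq_zero] using hv

theorem waring_le (hn : 0 < n) (hK : level K n = ⊤) :
    waring (PowerSeries K) n ≤ waring K n := by
  refine waring_le_waring hn fun l hl a ⟨m, f, ha⟩ => ?_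
  by_cases hf : ∀ i, f i = 0
  · exact ⟨0, by simp [ha, hf, hn.ne']⟩
  push Not at hf
  obtain ⟨i₀, hi₀⟩ := hf
  obtain ⟨j, -, hj⟩ := Finset.exists_min_image Finset.univ (fun i => (f i).order)
    ⟨i₀, Finset.mem_univ _⟩
  have hj0 : f j ≠ 0 := by
    intro h
    have := hj i₀ (Finset.mem_univ _)
    rw [h, order_zero, top_le_iff, order_eq_top] at this
    exact hi₀ this
  have hdvd : ∀ i, X ^ (f j).order.toNat ∣ f i := by
    intro i
    refine X_pow_dvd_iff.2 fun r hr => coeff_of_lt_order r ?_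
    refine lt_of_lt_of_le ?_ (hj i (Finset.mem_univ _))
    rw [← ENat.natCast_toNat (order_eq_top.not.2 hj0)]
    exact_mod_cast hr
  choose g hg using hdvd
  set N := (f j).order.toNat with hN
  have hgj : constantCoeff (g j) ≠ 0 := by
    have := coeff_order hj0
    rw [← hN, hg j] at this
    simpa [coeff_X_pow_mul'] using this
  obtain ⟨y, hy⟩ := hl (constantCoeff (∑ i, g i ^ n)) ⟨m, fun i => constantCoeff (g i), by simp⟩
  have hc : constantCoeff (∑ i, g i ^ n) ≠ 0 := by
    intro h
    simp only [map_sum, map_pow] at h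
    exact hgj (eq_zero_of_sum_pow_eq_zero hn hK h j)
  set c := constantCoeff (∑ i, g i ^ n)
  obtain ⟨v, hv⟩ := exists_pow_eq_of_constantCoeff_eq_one hn
    (natCast_ne_zero_of_level_eq_top hn hK) (u := C c⁻¹ * ∑ i, g i ^ n) (by
      rw [map_mul, constantCoeff_C]
      exact inv_mul_cancel₀ hc)
  refine ⟨fun i => X ^ N * v * C (y i), ?_⟩
  simp_rw [mul_pow, ← map_pow]
  rw [← Finset.mul_sum, ← map_sum, ← hy, hv, ha]
  have hcc : (C c⁻¹ : PowerSeries K) * C c = 1 := by rw [← map_mul, inv_mul_cancel₀ hc, map_one]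
  simp_rw [hg, mul_pow]
  rw [← Finset.mul_sum]
  linear_combination (-((X ^ N) ^ n * ∑ i, g i ^ n)) * hcc

end PowerSeries

section Laurent

variable {K : Type*} [Field K] {n : ℕ}

theorem level_laurentSeries_eq_top (hn : 0 < n) (hK : level K n = ⊤) :
    level (LaurentSeries K) n = ⊤ :=
  haveI : IsFractionRing (MvPowerSeries Unit K) (LaurentSeries K) :=
    inferInstanceAs (IsFractionRing (PowerSeries K) (LaurentSeries K))
  MvPowerSeries.level_fractionField_eq_top Unit K _ hn hK

theorem waring_le_waring_laurentSeries (hn : 0 < n) (hK : level K n = ⊤) :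
    waring K n ≤ waring (LaurentSeries K) n :=
  haveI : IsFractionRing (MvPowerSeries Unit K) (LaurentSeries K) :=
    inferInstanceAs (IsFractionRing (PowerSeries K) (LaurentSeries K))
  MvPowerSeries.waring_le_waring_fractionField Unit K _ hn hK

theorem waring_powerSeries_eq (hn : 0 < n) (hK : level K n = ⊤) :
    waring (PowerSeries K) n = waring K n :=
  (PowerSeries.waring_le hn hK).antisymm
    ((waring_le_waring_laurentSeries hn hK).trans (waring_fractionRing_le hn))

theorem waring_laurentSeries_eq (hn : 0 < n) (hK : level K n = ⊤) :
    waring (LaurentSeries K) n = waring K n :=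
  ((waring_fractionRing_le (R := PowerSeries K) hn).trans (PowerSeries.waring_le hn hK)).antisymm
    (waring_le_waring_laurentSeries hn hK)

end Laurent

theorem level_iterLaurent_eq_top {k : Type} [Field k] {n : ℕ} (hn : 0 < n) (hk : level k n = ⊤)
    (s : ℕ) : level (IterLaurent k s) n = ⊤ := by
  induction s with
  | zero => exact hk
  | succ s ih => exact level_laurentSeries_eq_top (K := IterLaurent k s) hn ih

theorem waring_iterLaurent_eq {k : Type} [Field k] {n : ℕ} (hn : 0 < n) (hk : level k n = ⊤)
    (s : ℕ) : waring (IterLaurent k s) n = waring k n := by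
  induction s with
  | zero => rfl
  | succ s ih =>
    exact (waring_laurentSeries_eq (K := IterLaurent k s) hn
      (level_iterLaurent_eq_top hn hk s)).trans ih

/-- Let `k` be a field and `n` a positive integer with `s_n(k) = ∞`. Then
`w_n(k((x₁))…((x_{s-1}))[[x_s]]) = w_n(k((x₁))…((x_s))) = w_n(k)` and
`w_n(k[[x₁,…,x_s]]) ≥ w_n(k((x₁,…,x_s))) ≥ w_n(k)`. -/
theorem waring_series_of_infinite_level (k : Type) [Field k] (n s : ℕ)
    (hn : 0 < n) (hs : 0 < s) (hlev : level k n = ⊤) :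
    waring (PowerSeries (IterLaurent k (s - 1))) n = waring k n ∧
      waring (IterLaurent k s) n = waring k n ∧
      waring (FractionRing (MvPowerSeries (Fin s) k)) n ≤ waring (MvPowerSeries (Fin s) k) n ∧
      waring k n ≤ waring (FractionRing (MvPowerSeries (Fin s) k)) n := by
  have : IsDomain (MvPowerSeries (Fin s) k) := NoZeroDivisors.to_isDomain _
  refine ⟨?_, waring_iterLaurent_eq hn hlev s, waring_fractionRing_le hn,
    MvPowerSeries.waring_le_waring_fractionField (Fin s) k _ hn hlev⟩
  rw [waring_powerSeries_eq hn (level_iterLaurent_eq_top hn hlev (s - 1)),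
    waring_iterLaurent_eq hn hlev]
end

section
/- Let p be an odd prime number, k a positive integer, and d a positive integer not divisible by p. Then w_{d·p^{k-1}·(p-1)}(ℤ_p) = w_{d·p^{k-1}·(p-1)}(ℚ_p) = p^k, where ℤ_p is the ring of p-adic integers and ℚ_p the field of p-adic numbers. -/
theorem PadicInt.norm_eq_one_of_dvd_sub_one {p : ℕ} [Fact p.Prime] {a : ℤ_[p]}
    (ha : (p : ℤ_[p]) ∣ a - 1) : ‖a‖ = 1 := by
  rw [← PadicInt.isUnit_iff]
  by_contra h
  rw [PadicInt.not_isUnit_iff, PadicInt.norm_lt_one_iff_dvd] at h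
  have h1 := dvd_sub h ha
  rw [sub_sub_cancel] at h1
  exact PadicInt.prime_p.not_isUnit (isUnit_of_dvd_one h1)

/-- Hensel's lemma for `X ^ n - u` at an approximate root congruent to `1` modulo `p`. -/
theorem PadicInt.exists_pow_eq_of_norm_lt {p : ℕ} [Fact p.Prime] {n : ℕ} {a u : ℤ_[p]}
    (ha : (p : ℤ_[p]) ∣ a - 1) (h : ‖a ^ n - u‖ < ‖(n : ℤ_[p])‖ ^ 2) :
    ∃ z : ℤ_[p], z ^ n = u ∧ (p : ℤ_[p]) ∣ z - 1 := by
  have hF : ∀ x : ℤ_[p], (Polynomial.X ^ n - Polynomial.C u : Polynomial ℤ_[p]).aeval x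
      = x ^ n - u := by
    intro x
    simp
  have hF' : ‖(Polynomial.X ^ n - Polynomial.C u : Polynomial ℤ_[p]).derivative.aeval a‖
      = ‖(n : ℤ_[p])‖ := by
    simp [Polynomial.derivative_X_pow, PadicInt.norm_eq_one_of_dvd_sub_one ha]
  obtain ⟨z, hz, hza, -⟩ := hensels_lemma
    (F := (Polynomial.X ^ n - Polynomial.C u : Polynomial ℤ_[p])) (a := a) (by rwa [hF, hF'])
  rw [hF, sub_eq_zero] at hz
  rw [hF'] at hza
  refine ⟨z, hz, ?_⟩
  have h1 := (PadicInt.norm_lt_one_iff_dvd _).1 (hza.trans_le (PadicInt.norm_le_one _))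
  simpa using dvd_add h1 ha

/-- A `p`-adic integer congruent to `1` modulo `p` has an `e`-th root if `p ∤ e`. -/
theorem PadicInt.exists_pow_eq_of_not_dvd {p : ℕ} [Fact p.Prime] {e : ℕ} (he : ¬ p ∣ e)
    {u : ℤ_[p]} (hu : (p : ℤ_[p]) ∣ u - 1) : ∃ z : ℤ_[p], z ^ e = u := by
  have hne : ‖(e : ℤ_[p])‖ = 1 := by
    rw [← PadicInt.isUnit_iff]
    by_contra h
    rw [PadicInt.not_isUnit_iff, PadicInt.norm_lt_one_iff_dvd] at h
    exact he (by
      have := (PadicInt.pow_p_dvd_int_iff (p := p) 1 (e : ℤ)).1 (by simpa using h)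
      rw [pow_one] at this
      exact_mod_cast this)
  obtain ⟨z, hz, -⟩ := PadicInt.exists_pow_eq_of_norm_lt (n := e) (a := 1) (u := u) (by simp) (by
    rw [hne, one_pow, one_pow, PadicInt.norm_lt_one_iff_dvd, dvd_sub_comm]
    exact hu)
  exact ⟨z, hz⟩

/-- For odd `p`, every element of `1 + p ^ (j + 2) ℤ_p` is the `p`-th power of an element of
`1 + p ^ (j + 1) ℤ_p`. -/
theorem PadicInt.exists_pow_prime_eq {p : ℕ} [hp : Fact p.Prime] (hodd : p ≠ 2) {j : ℕ}
    {u : ℤ_[p]} (hu : (p : ℤ_[p]) ^ (j + 2) ∣ u - 1) :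
    ∃ v : ℤ_[p], v ^ p = u ∧ (p : ℤ_[p]) ^ (j + 1) ∣ v - 1 := by
  have hp' : Odd p := hp.out.odd_of_ne_two hodd
  obtain ⟨t, ht⟩ := hu
  obtain ⟨c, hc⟩ := odd_sq_dvd_geom_sum₂_sub (a := (1 : ℤ_[p])) (b := (p : ℤ_[p]) ^ j * t) hp'
  have hgeom := (Commute.all (1 + (p : ℤ_[p]) * ((p : ℤ_[p]) ^ j * t)) 1).geom_sum₂_mul p
  have hdiff : (1 + (p : ℤ_[p]) * ((p : ℤ_[p]) ^ j * t)) ^ p - u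
      = (p : ℤ_[p]) ^ 3 * (c * (p : ℤ_[p]) ^ j * t) := by
    rw [sub_eq_iff_eq_add.1 hc] at hgeom
    simp only [one_pow] at hgeom
    linear_combination -ht - hgeom
  obtain ⟨v, hv, hv1⟩ := PadicInt.exists_pow_eq_of_norm_lt (n := p)
    (a := 1 + (p : ℤ_[p]) * ((p : ℤ_[p]) ^ j * t)) (u := u) (by simp) (by
      rw [hdiff, norm_mul, norm_pow, PadicInt.norm_p]
      have hp0 : (0 : ℝ) < (p : ℝ)⁻¹ := by
        have := hp.out.pos
        positivity
      have hp1 : (p : ℝ)⁻¹ < 1 := inv_lt_one_of_one_lt₀ (by exact_mod_cast hp.out.one_lt)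
      calc _ ≤ (p : ℝ)⁻¹ ^ 3 * 1 := by
            gcongr
            exact PadicInt.norm_le_one _
        _ < (p : ℝ)⁻¹ ^ 2 := by
            rw [mul_one]
            exact pow_lt_pow_right_of_lt_one₀ hp0 hp1 (by norm_num))
  refine ⟨v, hv, ?_⟩
  have hvp : ¬ (p : ℤ_[p]) ∣ v := by
    rw [← PadicInt.norm_lt_one_iff_dvd, PadicInt.norm_eq_one_of_dvd_sub_one hv1]
    exact lt_irrefl _
  have hmul := emultiplicity_pow_prime_sub_pow_prime PadicInt.prime_p hp' hv1 hvp
  rw [one_pow, hv] at hmul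
  have h2 : ((j + 2 : ℕ) : ℕ∞) ≤ emultiplicity (p : ℤ_[p]) (u - 1) :=
    pow_dvd_iff_le_emultiplicity.1 ⟨t, ht⟩
  rw [hmul] at h2
  rw [pow_dvd_iff_le_emultiplicity]
  have h3 : ((j + 1 : ℕ) : ℕ∞) + 1 ≤ emultiplicity (p : ℤ_[p]) (v - 1) + 1 := by
    exact_mod_cast h2
  exact (ENat.add_le_add_iff_right ENat.one_ne_top).1 h3

theorem PadicInt.exists_pow_prime_pow_eq {p : ℕ} [Fact p.Prime] (hodd : p ≠ 2) (j : ℕ)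
    {u : ℤ_[p]} (hu : (p : ℤ_[p]) ^ (j + 1) ∣ u - 1) :
    ∃ v : ℤ_[p], v ^ p ^ j = u ∧ (p : ℤ_[p]) ∣ v - 1 := by
  induction j generalizing u with
  | zero => exact ⟨u, by simp, by simpa using hu⟩
  | succ j ih =>
    obtain ⟨w, rfl, hw⟩ := PadicInt.exists_pow_prime_eq hodd hu
    obtain ⟨v, rfl, hv⟩ := ih hw
    exact ⟨v, by rw [pow_succ, pow_mul], hv⟩

/-- For odd `p` and `p ∤ e`, every element of `1 + p ^ (j + 1) ℤ_p` is an `e * p ^ j`-th power. -/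
theorem PadicInt.exists_pow_mul_prime_pow_eq {p : ℕ} [Fact p.Prime] (hodd : p ≠ 2) {e : ℕ}
    (he : ¬ p ∣ e) (j : ℕ) {u : ℤ_[p]} (hu : (p : ℤ_[p]) ^ (j + 1) ∣ u - 1) :
    ∃ v : ℤ_[p], v ^ (e * p ^ j) = u := by
  obtain ⟨w, rfl, hw⟩ := PadicInt.exists_pow_prime_pow_eq hodd j hu
  obtain ⟨v, rfl⟩ := PadicInt.exists_pow_eq_of_not_dvd he hw
  exact ⟨v, pow_mul _ _ _⟩

/-- If all elements of `1 + p ^ k ℤ_p` are `n`-th powers, then every `p`-adic integer is a sum of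
at most `p ^ k` `n`-th powers. -/
theorem PadicInt.exists_eq_sum_pow {p : ℕ} [hp : Fact p.Prime] {n k : ℕ}
    (hn : ∀ u : ℤ_[p], (p : ℤ_[p]) ^ k ∣ u - 1 → ∃ v : ℤ_[p], v ^ n = u) (a : ℤ_[p]) :
    ∃ l : ℕ, 0 < l ∧ l ≤ p ^ k ∧ ∃ x : Fin l → ℤ_[p], a = ∑ i, x i ^ n := by
  have : NeZero (p ^ k) := ⟨pow_ne_zero _ hp.out.ne_zero⟩
  set m := (PadicInt.toZModPow k (a - 1)).val with hm
  obtain ⟨v, hv⟩ := hn (a - m) (by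
    rw [← Ideal.mem_span_singleton, ← PadicInt.ker_toZModPow, RingHom.mem_ker, sub_right_comm,
      map_sub, map_natCast, hm, ZMod.natCast_zmod_val, sub_self])
  refine ⟨m + 1, m.succ_pos, ZMod.val_lt _, Fin.cons v fun _ => 1, ?_⟩
  simp [Fin.sum_univ_succ, hv]

/-- The image of an `n`-th power in `ℤ / p ^ k` is `0` or `1` if `n` is a sufficiently large
multiple of `φ (p ^ k)`. -/
theorem PadicInt.toZModPow_pow {p : ℕ} [Fact p.Prime] {n k : ℕ} (hkn : k ≤ n)
    (hφ : (p ^ k).totient ∣ n) (x : ℤ_[p]) [Decidable (IsUnit x)] :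
    PadicInt.toZModPow k (x ^ n) = if IsUnit x then 1 else 0 := by
  split_ifs with hx
  · obtain ⟨u, rfl⟩ := hx
    obtain ⟨c, rfl⟩ := hφ
    have h := congrArg Units.val
      (ZMod.pow_totient (Units.map (PadicInt.toZModPow (p := p) k).toMonoidHom u))
    simp only [Units.val_pow_eq_pow_val, Units.coe_map, Units.val_one] at h
    rw [map_pow, pow_mul]
    exact (congrArg (· ^ c) h).trans (one_pow c)
  · rw [PadicInt.not_isUnit_iff, PadicInt.norm_lt_one_iff_dvd] at hx
    rw [← RingHom.mem_ker, PadicInt.ker_toZModPow, Ideal.mem_span_singleton]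
    exact (pow_dvd_pow _ hkn).trans (pow_dvd_pow_of_dvd hx n)

/-- A representation of `p ^ (k + n * m)` as a sum of `n`-th powers in `ℤ_p` has at least `p ^ k`
summands. -/
theorem PadicInt.pow_le_of_eq_sum_pow {p : ℕ} [hp : Fact p.Prime] {n k l : ℕ} (hkn : k < n)
    (hφ : (p ^ k).totient ∣ n) (m : ℕ) (x : Fin l → ℤ_[p])
    (h : (p : ℤ_[p]) ^ (k + n * m) = ∑ i, x i ^ n) : p ^ k ≤ l := by
  classical
  by_cases hex : ∃ i, IsUnit (x i)
  · have h1 := congrArg (PadicInt.toZModPow k) h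
    rw [map_sum, Finset.sum_congr rfl fun i _ => PadicInt.toZModPow_pow hkn.le hφ (x i),
      Finset.sum_boole, map_pow, map_natCast, pow_add, ← Nat.cast_pow, ZMod.natCast_self,
      zero_mul, eq_comm, ZMod.natCast_eq_zero_iff] at h1
    obtain ⟨i, hi⟩ := hex
    refine (Nat.le_of_dvd (Finset.card_pos.2 ⟨i, by simpa using hi⟩) h1).trans ?_
    exact (Finset.card_le_univ _).trans_eq (Fintype.card_fin l)
  · push Not at hex
    have hdvd : ∀ i, (p : ℤ_[p]) ∣ x i := fun i => by
      rw [← PadicInt.norm_lt_one_iff_dvd, ← PadicInt.not_isUnit_iff]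
      exact hex i
    choose y hy using hdvd
    have h2 : (p : ℤ_[p]) ^ (k + n * m) = (p : ℤ_[p]) ^ n * ∑ i, y i ^ n := by
      rw [h, Finset.mul_sum]
      exact Finset.sum_congr rfl fun i _ => by rw [hy i, mul_pow]
    cases m with
    | zero =>
      have h3 : (p : ℤ_[p]) ^ n ∣ (p : ℤ_[p]) ^ k := ⟨_, by simpa using h2⟩
      rw [pow_dvd_pow_iff PadicInt.prime_p.ne_zero PadicInt.prime_p.not_isUnit] at h3
      omega
    | succ m =>
      refine PadicInt.pow_le_of_eq_sum_pow hkn hφ m y ?_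
      refine mul_left_cancel₀ (pow_ne_zero n PadicInt.prime_p.ne_zero) (Eq.trans ?_ h2)
      ring

theorem Padic.exists_pow_mul_eq_coe {p : ℕ} [hp : Fact p.Prime] (a : ℚ_[p]) :
    ∃ m : ℕ, ∀ m' : ℕ, m ≤ m' → ∃ b : ℤ_[p], (p : ℚ_[p]) ^ m' * a = b := by
  obtain ⟨m, hm⟩ := pow_unbounded_of_one_lt ‖a‖
    (show (1 : ℝ) < p by exact_mod_cast hp.out.one_lt)
  refine ⟨m, fun m' hm' => ⟨⟨(p : ℚ_[p]) ^ m' * a, ?_⟩, rfl⟩⟩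
  have hp1 : (1 : ℝ) ≤ p := by exact_mod_cast hp.out.one_lt.le
  rw [norm_mul, norm_pow, Padic.norm_p, inv_pow, inv_mul_le_one₀ (by positivity)]
  exact hm.le.trans (pow_le_pow_right₀ hp1 hm')

theorem nLength_le_iff {R : Type*} [CommRing R] {n : ℕ} {a : R} {g : ℕ} :
    nLength R n a ≤ g ↔ ∃ l : ℕ, 0 < l ∧ l ≤ g ∧ ∃ x : Fin l → R, a = ∑ i, x i ^ n := by
  constructor
  · intro h
    have hne : {g : ℕ∞ | ∃ l : ℕ, g = l ∧ 0 < l ∧ ∃ x : Fin l → R, a = ∑ i, x i ^ n}.Nonempty := by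
      by_contra hne
      rw [Set.not_nonempty_iff_eq_empty] at hne
      rw [nLength, hne, sInf_empty] at h
      exact ENat.natCast_ne_top g (top_le_iff.1 h)
    obtain ⟨l, hl, hpos, hx⟩ := csInf_mem hne
    refine ⟨l, hpos, ?_, hx⟩
    rw [nLength, hl] at h
    exact_mod_cast h
  · rintro ⟨l, hpos, hle, hx⟩
    have h : nLength R n a ≤ l := sInf_le ⟨l, rfl, hpos, hx⟩
    exact h.trans (by exact_mod_cast hle)

/-- The Waring number is `g` if every element is a sum of at most `g` powers and some element
needs `g` of them. -/
theorem waring_eq_of_forall_of_exists {R : Type*} [CommRing R] {n g : ℕ} (hg : 0 < g)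
    (hupper : ∀ a : R, ∃ l : ℕ, 0 < l ∧ l ≤ g ∧ ∃ x : Fin l → R, a = ∑ i, x i ^ n)
    (hlower : ∃ a : R, ∀ (l : ℕ) (x : Fin l → R), a = ∑ i, x i ^ n → g ≤ l) :
    waring R n = g := by
  refine le_antisymm (sInf_le ⟨g, rfl, hg, fun a _ => nLength_le_iff.2 (hupper a)⟩)
    (le_sInf ?_)
  rintro _ ⟨l, rfl, -, hl⟩
  obtain ⟨a, ha⟩ := hlower
  obtain ⟨l₀, -, -, x₀, hx₀⟩ := hupper a
  obtain ⟨l', -, hle, x, hx⟩ := nLength_le_iff.1 (hl a ⟨l₀, x₀, hx₀⟩)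
  exact_mod_cast (ha l' x hx).trans hle

/-- Let `p` be an odd prime, `k ≥ 1` and `p ∤ d`. Then
`w_{d·p^(k-1)·(p-1)}(ℤ_p) = w_{d·p^(k-1)·(p-1)}(ℚ_p) = p^k`. -/
theorem waring_padic_totient (p : ℕ) [hp : Fact p.Prime] (hodd : p ≠ 2)
    (k d : ℕ) (hk : 0 < k) (hd : 0 < d) (hpd : ¬ p ∣ d) :
    waring ℤ_[p] (d * p ^ (k - 1) * (p - 1)) = p ^ k ∧
      waring ℚ_[p] (d * p ^ (k - 1) * (p - 1)) = p ^ k := by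
  obtain ⟨j, rfl⟩ : ∃ j, k = j + 1 := ⟨k - 1, by omega⟩
  rw [Nat.add_sub_cancel]
  have hp2 := hp.out.two_le
  have he : ¬ p ∣ d * (p - 1) := by
    rw [hp.out.dvd_mul, not_or]
    exact ⟨hpd, Nat.not_dvd_of_pos_of_lt (by omega) (by omega)⟩
  set n := d * p ^ j * (p - 1) with hn
  have hroot : ∀ u : ℤ_[p], (p : ℤ_[p]) ^ (j + 1) ∣ u - 1 → ∃ v : ℤ_[p], v ^ n = u := by
    intro u hu
    rw [hn, mul_right_comm]
    exact PadicInt.exists_pow_mul_prime_pow_eq hodd he j hu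
  have hφ : (p ^ (j + 1)).totient ∣ n := by
    rw [Nat.totient_prime_pow_succ hp.out, hn, mul_assoc]
    exact dvd_mul_left _ _
  have hkn : j + 1 < n := by
    have h1 : j < p ^ j := Nat.lt_pow_self hp.out.one_lt
    have h2 : 1 * p ^ j * 2 ≤ n :=
      Nat.mul_le_mul (Nat.mul_le_mul_right _ hd) (by omega)
    omega
  have hpos : 0 < p ^ (j + 1) := pow_pos hp.out.pos _
  have hp0 : (p : ℚ_[p]) ≠ 0 := by exact_mod_cast hp.out.ne_zero
  rw [← Nat.cast_pow]
  refine ⟨waring_eq_of_forall_of_exists hpos (PadicInt.exists_eq_sum_pow hroot)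
    ⟨(p : ℤ_[p]) ^ (j + 1), fun l x hx =>
      PadicInt.pow_le_of_eq_sum_pow hkn hφ 0 x (by simpa using hx)⟩,
    waring_eq_of_forall_of_exists hpos (fun a => ?_)
      ⟨(p : ℚ_[p]) ^ (j + 1), fun l x hx => ?_⟩⟩
  · obtain ⟨m, hm⟩ := Padic.exists_pow_mul_eq_coe a
    obtain ⟨b, hb⟩ := hm (m * n) (Nat.le_mul_of_pos_right m (by omega))
    obtain ⟨l, hl, hle, x, rfl⟩ := PadicInt.exists_eq_sum_pow hroot b
    refine ⟨l, hl, hle, fun i => x i / (p : ℚ_[p]) ^ m, ?_⟩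
    simp only [div_pow, ← Finset.sum_div, ← pow_mul]
    rw [eq_div_iff (pow_ne_zero _ hp0), mul_comm, hb]
    rw [PadicInt.coe_sum]
    push_cast
    rfl
  · choose m hm using fun i => Padic.exists_pow_mul_eq_coe (x i)
    choose y hy using fun i => hm i (∑ i, m i)
      (Finset.single_le_sum (fun _ _ => Nat.zero_le _) (Finset.mem_univ i))
    refine PadicInt.pow_le_of_eq_sum_pow hkn hφ (∑ i, m i) y ?_
    apply PadicInt.ext
    rw [PadicInt.coe_sum]
    push_cast
    rw [pow_add, hx, Finset.sum_mul]
    refine Finset.sum_congr rfl fun i _ => ?_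
    rw [← hy i]
    ring
end

section
/- Let k and d be positive integers with d odd, and let n = 2^k·d. Then w_n(ℤ_2) = w_n(ℚ_2), and this common value equals 4 if k = 1 and d = 1; equals 15 if k = 2 and d = 1; and equals 2^{k+2} if k > 2 or d ≥ 3. Here ℤ_2 is the ring of 2-adic integers and ℚ_2 the field of 2-adic numbers. -/
/-- Bounds on the lengths of representations determine the Waring number. -/
lemma waring_eq_of_bounds {R : Type*} [CommRing R] {n g : ℕ} (hg : 0 < g)
    (upper : ∀ a : R, ∃ l, 0 < l ∧ l ≤ g ∧ ∃ x : Fin l → R, a = ∑ i, x i ^ n)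
    (a : R) (lower : ∀ l (x : Fin l → R), a = ∑ i, x i ^ n → g ≤ l) :
    waring R n = g := by
  apply le_antisymm
  · refine sInf_le ⟨g, rfl, hg, fun b _ => ?_⟩
    obtain ⟨l, hl, hlg, x, hx⟩ := upper b
    have hb : nLength R n b ≤ l := sInf_le ⟨l, rfl, hl, x, hx⟩
    exact hb.trans (by exact_mod_cast hlg)
  · refine le_sInf ?_
    rintro _ ⟨l, rfl, -, h⟩
    obtain ⟨m, -, -, x, hx⟩ := upper a
    refine le_trans (le_sInf ?_) (h a ⟨m, x, hx⟩)
    rintro _ ⟨m, rfl, -, x, hx⟩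
    exact_mod_cast lower m x hx

lemma PadicInt.two_dvd_iff_norm_lt_one (x : ℤ_[2]) : 2 ∣ x ↔ ‖x‖ < 1 := by
  have := PadicInt.norm_lt_one_iff_dvd x
  exact_mod_cast this.symm

lemma PadicInt.two_dvd_or_two_dvd_sub_one (x : ℤ_[2]) : 2 ∣ x ∨ 2 ∣ x - 1 := by
  obtain ⟨m, hm, h⟩ := PadicInt.exists_mem_range (p := 2) x
  rw [PadicInt.maximalIdeal_eq_span_p, Ideal.mem_span_singleton] at h
  interval_cases m
  · left; simpa using h
  · right; simpa using h

lemma PadicInt.two_dvd_sub_one_iff_isUnit (x : ℤ_[2]) : 2 ∣ x - 1 ↔ IsUnit x := by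
  rw [PadicInt.isUnit_iff]
  constructor
  · intro h
    refine le_antisymm x.norm_le_one (not_lt.mp fun hx => ?_)
    rw [← PadicInt.two_dvd_iff_norm_lt_one] at hx
    have h1 : (2 : ℤ_[2]) ∣ 1 := by simpa using dvd_sub hx h
    rw [PadicInt.two_dvd_iff_norm_lt_one] at h1
    simp at h1
  · intro h
    refine (PadicInt.two_dvd_or_two_dvd_sub_one x).resolve_left fun h2 => ?_
    rw [PadicInt.two_dvd_iff_norm_lt_one] at h2
    exact h2.ne h

/-- The `2 ^ k * d`-th powers of 2-adic units are `1` modulo `2 ^ (k + 2)`. -/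
lemma PadicInt.two_pow_dvd_unit_pow_sub_one {k : ℕ} (hk : 0 < k) (d : ℕ) {x : ℤ_[2]}
    (hx : IsUnit x) : 2 ^ (k + 2) ∣ x ^ (2 ^ k * d) - 1 := by
  have key : 2 ^ (k + 2) ∣ x ^ 2 ^ k - 1 := by
    induction k, hk using Nat.le_induction with
    | base =>
      obtain ⟨c, hc⟩ := (PadicInt.two_dvd_sub_one_iff_isUnit x).2 hx
      obtain ⟨e, he⟩ : 2 ∣ c * (c + 1) := by
        rcases PadicInt.two_dvd_or_two_dvd_sub_one c with h | h
        · exact h.mul_right _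
        · refine Dvd.dvd.mul_left ?_ _
          have : c + 1 = c - 1 + 2 := by ring
          exact this ▸ dvd_add h dvd_rfl
      refine ⟨e, ?_⟩
      have : x = 1 + 2 * c := by linear_combination hc
      subst this
      linear_combination 4 * he
    | succ k hk ih =>
      obtain ⟨c, hc⟩ := ih
      refine ⟨c + 2 ^ (k + 1) * c ^ 2, ?_⟩
      have : x ^ 2 ^ k = 1 + 2 ^ (k + 2) * c := by linear_combination hc
      rw [pow_succ 2 k, pow_mul, this]
      ring
  rw [pow_mul]
  exact key.trans (by simpa using sub_dvd_pow_sub_pow (x ^ 2 ^ k) 1 d)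

lemma PadicInt.norm_two : ‖(2 : ℤ_[2])‖ = 2⁻¹ := by
  simpa using PadicInt.norm_p (p := 2)

lemma PadicInt.norm_le_of_two_pow_dvd {x : ℤ_[2]} {m : ℕ} (h : 2 ^ m ∣ x) :
    ‖x‖ ≤ (2⁻¹ : ℝ) ^ m := by
  obtain ⟨c, rfl⟩ := h
  rw [norm_mul, norm_pow, PadicInt.norm_two]
  exact mul_le_of_le_one_right (by positivity) c.norm_le_one

lemma PadicInt.exists_sq_eq {a : ℤ_[2]} {m : ℕ} (h : 2 ^ (m + 3) ∣ a - 1) :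
    ∃ b : ℤ_[2], b ^ 2 = a ∧ 2 ^ (m + 2) ∣ b - 1 := by
  have ha := PadicInt.norm_le_of_two_pow_dvd ((pow_dvd_pow 2 (by omega : 3 ≤ m + 3)).trans h)
  have hd : (Polynomial.derivative (Polynomial.X ^ 2 - Polynomial.C a)).eval 1 = 2 := by
    simp [one_add_one_eq_two]
  have he : (Polynomial.X ^ 2 - Polynomial.C a).eval 1 = 1 - a := by simp
  obtain ⟨z, hz, hz1, -⟩ := hensels_lemma (R := ℤ_[2]) (F := Polynomial.X ^ 2 - Polynomial.C a) (a := 1) (by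
    rw [Polynomial.coe_aeval_eq_eval, hd, he, norm_sub_rev, PadicInt.norm_two]
    exact ha.trans_lt (by norm_num))
  rw [Polynomial.coe_aeval_eq_eval] at hz hz1
  rw [hd, PadicInt.norm_two] at hz1
  have hz2 : z ^ 2 = a := by simpa [sub_eq_zero] using hz
  refine ⟨z, hz2, ?_⟩
  have h2 : (2 : ℤ_[2]) ∣ z - 1 := by
    rw [PadicInt.two_dvd_iff_norm_lt_one]
    exact hz1.trans (by norm_num)
  obtain ⟨c, hc⟩ := h2
  have hc2 : 2 ∣ c := by
    rw [PadicInt.two_dvd_iff_norm_lt_one]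
    rw [hc, norm_mul, PadicInt.norm_two] at hz1
    linarith
  have hu : IsUnit (c + 1) := by
    rw [← PadicInt.two_dvd_sub_one_iff_isUnit]
    simpa using hc2
  obtain ⟨e, he⟩ := h
  have hmul : 2 ^ (m + 1) * e = c * (c + 1) := by
    have hz' : z = 1 + 2 * c := by linear_combination hc
    have h4 : (4 : ℤ_[2]) ≠ 0 := by norm_num
    apply mul_left_cancel₀ h4
    subst hz'
    linear_combination -hz2 - he
  rw [hc, show m + 2 = (m + 1) + 1 by rfl, pow_succ']
  exact mul_dvd_mul_left 2 (hu.dvd_mul_right.1 ⟨e, hmul.symm⟩)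

lemma PadicInt.exists_odd_pow_eq {d : ℕ} (hd : Odd d) {a : ℤ_[2]} (h : 2 ∣ a - 1) :
    ∃ b : ℤ_[2], b ^ d = a := by
  have hdn : ‖(d : ℤ_[2])‖ = 1 := by
    rw [← PadicInt.isUnit_iff, ← PadicInt.two_dvd_sub_one_iff_isUnit]
    obtain ⟨e, rfl⟩ := hd
    exact ⟨e, by push_cast; ring⟩
  obtain ⟨z, hz, -⟩ := hensels_lemma (R := ℤ_[2]) (F := Polynomial.X ^ d - Polynomial.C a) (a := 1) (by
    rw [PadicInt.two_dvd_iff_norm_lt_one, norm_sub_rev] at h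
    rw [Polynomial.coe_aeval_eq_eval]
    simpa [Polynomial.derivative_X_pow, hdn] using h)
  exact ⟨z, by simpa [sub_eq_zero] using hz⟩

/-- Every 2-adic integer congruent to `1` modulo `2 ^ (k + 2)` is a `2 ^ k * d`-th power. -/
lemma PadicInt.exists_pow_eq_of_two_pow_dvd_sub_one {k d : ℕ} (hd : Odd d) {a : ℤ_[2]}
    (h : 2 ^ (k + 2) ∣ a - 1) : ∃ b : ℤ_[2], b ^ (2 ^ k * d) = a := by
  induction k generalizing a with
  | zero =>
    simpa using PadicInt.exists_odd_pow_eq hd ((dvd_pow_self 2 (by simp)).trans h)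
  | succ k ih =>
    obtain ⟨c, rfl, hc⟩ := PadicInt.exists_sq_eq h
    obtain ⟨b, rfl⟩ := ih hc
    exact ⟨b, by rw [← pow_mul]; ring⟩

/-- Every 2-adic integer is a `2 ^ k * d`-th power plus a natural number below `2 ^ (k + 2)`. -/
lemma PadicInt.exists_pow_add_natCast {k d : ℕ} (hd : Odd d) (a : ℤ_[2]) :
    ∃ (b : ℤ_[2]) (s : ℕ), s < 2 ^ (k + 2) ∧ a = b ^ (2 ^ k * d) + s ∧
      2 ^ (k + 2) ∣ a - (s + 1) := by
  have h := PadicInt.appr_spec (k + 2) (a - 1)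
  rw [Ideal.mem_span_singleton] at h
  have hs := PadicInt.appr_lt (a - 1) (k + 2)
  set s := (a - 1).appr (k + 2)
  push_cast at h
  obtain ⟨b, hb⟩ := PadicInt.exists_pow_eq_of_two_pow_dvd_sub_one hd (a := a - s)
    (by rwa [sub_right_comm])
  refine ⟨b, s, hs, by rw [hb]; ring, ?_⟩
  rwa [add_comm (s : ℤ_[2]), ← sub_sub]

/-- Powers of `2 ^ n` may be removed when bounding the number of `n`-th powers needed. -/
lemma PadicInt.exists_sum_pow_of_not_dvd {n g : ℕ} (hn : 0 < n) (hg : 0 < g)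
    (h : ∀ a : ℤ_[2], ¬ 2 ^ n ∣ a →
      ∃ l, 0 < l ∧ l ≤ g ∧ ∃ x : Fin l → ℤ_[2], a = ∑ i, x i ^ n) (a : ℤ_[2]) :
    ∃ l, 0 < l ∧ l ≤ g ∧ ∃ x : Fin l → ℤ_[2], a = ∑ i, x i ^ n := by
  rcases eq_or_ne a 0 with rfl | ha
  · exact ⟨1, one_pos, hg, 0, by simp [hn.ne']⟩
  have h2 : ¬ IsUnit ((2 : ℤ_[2]) ^ n) := by
    rw [isUnit_pow_iff hn.ne', PadicInt.isUnit_iff, PadicInt.norm_two]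
    norm_num
  obtain ⟨b, hab, hb⟩ :=
    (FiniteMultiplicity.of_not_isUnit h2 ha).exists_eq_pow_mul_and_not_dvd
  set c := multiplicity ((2 : ℤ_[2]) ^ n) a
  obtain ⟨l, hl, hlg, x, hx⟩ := h b hb
  refine ⟨l, hl, hlg, fun i => 2 ^ c * x i, ?_⟩
  rw [hab, hx, Finset.mul_sum]
  refine Finset.sum_congr rfl fun i _ => ?_
  rw [mul_pow, ← pow_mul, ← pow_mul, mul_comm n c]

lemma Padic.exists_sum_pow_of_padicInt {n g : ℕ} (hn : 0 < n)
    (h : ∀ a : ℤ_[2], ∃ l, 0 < l ∧ l ≤ g ∧ ∃ x : Fin l → ℤ_[2], a = ∑ i, x i ^ n)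
    (a : ℚ_[2]) :
    ∃ l, 0 < l ∧ l ≤ g ∧ ∃ x : Fin l → ℚ_[2], a = ∑ i, x i ^ n := by
  obtain ⟨j, hj⟩ := pow_unbounded_of_one_lt ‖a‖ (one_lt_two : (1 : ℝ) < 2)
  have h2 : ‖(2 : ℚ_[2])‖ = 2⁻¹ := by simpa using Padic.norm_p (p := 2)
  have hle : ‖((2 : ℚ_[2]) ^ j) ^ n * a‖ ≤ 1 := by
    rw [norm_mul, norm_pow, norm_pow, h2]
    calc ((2⁻¹ : ℝ) ^ j) ^ n * ‖a‖ ≤ (2⁻¹ : ℝ) ^ j * 2 ^ j := by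
          gcongr
          exact pow_le_of_le_one (by positivity)
            (pow_le_one₀ (by norm_num) (by norm_num)) hn.ne'
      _ = 1 := by rw [← mul_pow]; norm_num
  obtain ⟨l, hl, hlg, x, hx⟩ := h ⟨_, hle⟩
  refine ⟨l, hl, hlg, fun i => x i / 2 ^ j, ?_⟩
  have hx' := congrArg (fun z : ℤ_[2] => (z : ℚ_[2])) hx
  simp only [PadicInt.coe_sum, PadicInt.coe_pow] at hx'
  simp only [div_pow]
  rw [← Finset.sum_div, ← hx', mul_div_cancel_left₀]
  exact pow_ne_zero _ (pow_ne_zero _ two_ne_zero)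

/-- A representation over `ℚ_[2]` can be scaled to a primitive one over `ℤ_[2]`. -/
lemma Padic.exists_primitive_sum_pow {n N l : ℕ} (hN : ¬ 2 ^ n ∣ N) (hn : 0 < n)
    (x : Fin l → ℚ_[2]) (hx : (N : ℚ_[2]) = ∑ i, x i ^ n) :
    ∃ (j : ℕ) (y : Fin l → ℤ_[2]), (∃ i, IsUnit (y i)) ∧
      (2 : ℤ_[2]) ^ (n * j) * N = ∑ i, y i ^ n := by
  have hN0 : N ≠ 0 := by rintro rfl; simp at hN
  have hl : Nonempty (Fin l) := by
    by_contra hc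
    rw [not_nonempty_iff] at hc
    simp [hN0] at hx
  obtain ⟨i, hi⟩ := Finite.exists_max fun i => ‖x i‖
  have hxi : x i ≠ 0 := by
    intro h0
    have hz : ∀ j, x j = 0 := fun j => by simpa [h0] using hi j
    simp [hz, hn.ne', hN0] at hx
  have h2 : ‖(2 : ℚ_[2])‖ = 2⁻¹ := by simpa using Padic.norm_p (p := 2)
  have h20 : (2 : ℚ_[2]) ≠ 0 := by norm_num
  have coe_two : ((2 : ℤ_[2]) : ℚ_[2]) = 2 := rfl
  set v := (x i).valuation with hv
  have hnorm : ‖x i‖ = (2 : ℝ) ^ (-v) := by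
    simpa using Padic.norm_eq_zpow_neg_valuation hxi
  have hy : ∀ m, ‖x m * (2 : ℚ_[2]) ^ (-v)‖ ≤ 1 := by
    intro m
    rw [norm_mul, norm_zpow, h2]
    calc ‖x m‖ * (2⁻¹ : ℝ) ^ (-v) ≤ ‖x i‖ * (2⁻¹ : ℝ) ^ (-v) := by gcongr; exact hi m
      _ = 1 := by rw [hnorm, ← mul_zpow]; norm_num
  let y : Fin l → ℤ_[2] := fun m => ⟨_, hy m⟩
  have hyi : IsUnit (y i) := by
    rw [PadicInt.isUnit_iff]
    change ‖x i * (2 : ℚ_[2]) ^ (-v)‖ = 1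
    rw [norm_mul, norm_zpow, h2, hnorm, ← mul_zpow]
    norm_num
  have hsum : (N : ℚ_[2]) * ((2 : ℚ_[2]) ^ (-v)) ^ n = ((∑ m, y m ^ n : ℤ_[2]) : ℚ_[2]) := by
    rw [hx, PadicInt.coe_sum, Finset.sum_mul]
    refine Finset.sum_congr rfl fun m _ => ?_
    rw [PadicInt.coe_pow, ← mul_pow]
  rcases le_or_gt v 0 with hv0 | hv0
  · refine ⟨(-v).toNat, y, ⟨i, hyi⟩, PadicInt.ext ?_⟩
    rw [← hsum]
    obtain ⟨j, hj⟩ := Int.eq_ofNat_of_zero_le (neg_nonneg.2 hv0)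
    simp only [hj, Int.toNat_natCast, zpow_natCast]
    push_cast
    rw [coe_two]
    ring
  · exfalso
    obtain ⟨j, hj⟩ := Int.eq_ofNat_of_zero_le hv0.le
    have hj0 : j ≠ 0 := by omega
    have hd : (2 : ℤ_[2]) ^ (n * j) ∣ (N : ℤ_[2]) := by
      refine ⟨∑ m, y m ^ n, PadicInt.ext ?_⟩
      rw [PadicInt.coe_mul, ← hsum, hj]
      push_cast
      rw [coe_two, zpow_neg, zpow_natCast, inv_pow, ← pow_mul, mul_comm n j]
      field_simp
    have hd' : (2 : ℤ_[2]) ^ n ∣ (N : ℤ_[2]) :=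
      (pow_dvd_pow 2 (Nat.le_mul_of_pos_right n (Nat.pos_of_ne_zero hj0))).trans hd
    apply hN
    have h3 := (PadicInt.norm_int_le_pow_iff_dvd (p := 2) (k := (N : ℤ)) (n := n)).1 (by
      simpa [zpow_neg] using PadicInt.norm_le_of_two_pow_dvd hd')
    exact_mod_cast h3

/-- Upper bounds over `ℤ_[2]` together with a lower bound for primitive representations of
multiples of a single integer give the Waring number of both rings. -/
lemma waring_padicInt_and_padic {n g N : ℕ} (hn : 0 < n) (hg : 0 < g)
    (upper : ∀ a : ℤ_[2], ∃ l, 0 < l ∧ l ≤ g ∧ ∃ x : Fin l → ℤ_[2], a = ∑ i, x i ^ n)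
    (hN : ¬ 2 ^ n ∣ N)
    (lower : ∀ (l j : ℕ) (y : Fin l → ℤ_[2]), (∃ i, IsUnit (y i)) →
      (2 : ℤ_[2]) ^ (n * j) * N = ∑ i, y i ^ n → g ≤ l) :
    waring ℤ_[2] n = g ∧ waring ℚ_[2] n = g := by
  have key : ∀ l (x : Fin l → ℚ_[2]), (N : ℚ_[2]) = ∑ i, x i ^ n → g ≤ l := by
    intro l x hx
    obtain ⟨j, y, hy, hs⟩ := Padic.exists_primitive_sum_pow hN hn x hx
    exact lower l j y hy hs
  refine ⟨waring_eq_of_bounds hg upper N fun l x hx => key l (fun i => x i) ?_,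
    waring_eq_of_bounds hg (Padic.exists_sum_pow_of_padicInt hn upper) N key⟩
  have hx' := congrArg (fun z : ℤ_[2] => (z : ℚ_[2])) hx
  simpa using hx'

lemma PadicInt.exists_sum_pow_le_two_pow {k d : ℕ} (hd : Odd d) (a : ℤ_[2]) :
    ∃ l, 0 < l ∧ l ≤ 2 ^ (k + 2) ∧ ∃ x : Fin l → ℤ_[2], a = ∑ i, x i ^ (2 ^ k * d) := by
  obtain ⟨b, s, hs, hab, -⟩ := PadicInt.exists_pow_add_natCast (k := k) hd a
  exact ⟨s + 1, s.succ_pos, hs, Fin.cons b fun _ => 1, by simp [Fin.sum_univ_succ, hab]⟩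

/-- Modulo `2 ^ (k + 2)`, a primitive sum of `l` powers is an integer between `1` and `l`. -/
lemma PadicInt.exists_natCast_sub_sum_pow {k d l : ℕ} (hk : 0 < k) (hn : k + 2 ≤ 2 ^ k * d)
    (y : Fin l → ℤ_[2]) (hy : ∃ i, IsUnit (y i)) :
    ∃ t : ℕ, 0 < t ∧ t ≤ l ∧ 2 ^ (k + 2) ∣ ∑ i, y i ^ (2 ^ k * d) - (t : ℤ_[2]) := by
  classical
  obtain ⟨i, hi⟩ := hy
  refine ⟨(Finset.univ.filter fun i => IsUnit (y i)).card,
    Finset.card_pos.2 ⟨i, by simpa using hi⟩, (Finset.card_le_univ _).trans (by simp), ?_⟩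
  rw [Finset.card_filter, Nat.cast_sum, ← Finset.sum_sub_distrib]
  refine Finset.dvd_sum fun m _ => ?_
  by_cases hm : IsUnit (y m)
  · simpa [hm] using PadicInt.two_pow_dvd_unit_pow_sub_one hk d hm
  · have h2 : 2 ∣ y m := (PadicInt.two_dvd_or_two_dvd_sub_one _).resolve_right
      fun h => hm ((PadicInt.two_dvd_sub_one_iff_isUnit _).1 h)
    simpa [hm] using (pow_dvd_pow 2 hn).trans (pow_dvd_pow_of_dvd h2 _)

lemma PadicInt.two_pow_dvd_intCast {m : ℕ} {z : ℤ} (h : (2 : ℤ_[2]) ^ m ∣ (z : ℤ_[2])) :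
    2 ^ m ∣ z := by
  have h3 := (PadicInt.norm_int_le_pow_iff_dvd (p := 2) (k := z) (n := m)).1 (by
    simpa [zpow_neg] using PadicInt.norm_le_of_two_pow_dvd h)
  exact_mod_cast h3

lemma waring_two_adic_generic {k d : ℕ} (hk : 0 < k) (hd : Odd d)
    (hn : k + 2 < 2 ^ k * d) :
    waring ℤ_[2] (2 ^ k * d) = (2 ^ (k + 2) : ℕ) ∧
      waring ℚ_[2] (2 ^ k * d) = (2 ^ (k + 2) : ℕ) := by
  refine waring_padicInt_and_padic (N := 2 ^ (k + 2)) (by omega) (by positivity)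
    (PadicInt.exists_sum_pow_le_two_pow hd) ?_ ?_
  · rw [Nat.pow_dvd_pow_iff_le_right (by norm_num)]
    omega
  · intro l j y hy hs
    obtain ⟨t, ht0, htl, ht⟩ := PadicInt.exists_natCast_sub_sum_pow hk hn.le y hy
    rw [← hs] at ht
    have h1 : (2 : ℤ_[2]) ^ (k + 2) ∣ ((t : ℤ) : ℤ_[2]) := by
      have := dvd_sub (Dvd.intro_left ((2 : ℤ_[2]) ^ (2 ^ k * d * j)) rfl) ht
      simpa using this
    have h2 := PadicInt.two_pow_dvd_intCast h1
    exact (Nat.le_of_dvd ht0 (by exact_mod_cast h2)).trans htl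

lemma waring_two_adic_four :
    waring ℤ_[2] (2 ^ 2 * 1) = (15 : ℕ) ∧ waring ℚ_[2] (2 ^ 2 * 1) = (15 : ℕ) := by
  refine waring_padicInt_and_padic (N := 15) (by norm_num) (by norm_num)
    (PadicInt.exists_sum_pow_of_not_dvd (by norm_num) (by norm_num) ?_) (by norm_num) ?_
  · intro a ha
    obtain ⟨b, s, hs, hab, hdvd⟩ := PadicInt.exists_pow_add_natCast (k := 2) odd_one a
    refine ⟨s + 1, s.succ_pos, ?_, Fin.cons b fun _ => 1, by simp [Fin.sum_univ_succ, hab]⟩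
    by_contra hlt
    obtain rfl : s = 15 := by omega
    apply ha
    have h16 : (2 : ℤ_[2]) ^ (2 + 2) ∣ (15 : ℕ) + 1 := ⟨1, by norm_num⟩
    simpa using dvd_add hdvd h16
  · intro l j y hy hs
    obtain ⟨t, ht0, htl, ht⟩ :=
      PadicInt.exists_natCast_sub_sum_pow (k := 2) (d := 1) (by norm_num) (by norm_num) y hy
    rw [← hs] at ht
    have h1 : (2 : ℤ_[2]) ^ (2 + 2) ∣ ((2 ^ (4 * j) * 15 - t : ℤ) : ℤ_[2]) := by
      simpa using ht
    have h2 := PadicInt.two_pow_dvd_intCast h1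
    rw [pow_mul] at h2
    cases j with
    | zero => omega
    | succ j =>
      rw [pow_succ] at h2
      omega

lemma ZMod.four_le_of_primitive_sum_sq {l j : ℕ} (z : Fin l → ZMod 8)
    (hz : ∃ i, z i ^ 2 = 1) (hs : 2 ^ (2 * j) * 7 = ∑ i, z i ^ 2) : 4 ≤ l := by
  have hc : (2 : ZMod 8) ^ (2 * j) * 7 = 7 ∨ (2 : ZMod 8) ^ (2 * j) * 7 = 4 ∨
      (2 : ZMod 8) ^ (2 * j) * 7 = 0 := by
    match j with
    | 0 => left; rfl
    | 1 => right; left; rfl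
    | j + 2 =>
      right; right
      rw [show 2 * (j + 2) = 2 * j + 4 by ring, pow_add, mul_assoc,
        show (2 : ZMod 8) ^ 4 * 7 = 0 from rfl, mul_zero]
  rw [hs] at hc
  by_contra! hl
  obtain ⟨i, hi⟩ := hz
  interval_cases l
  · exact i.elim0
  · simp only [Fin.sum_univ_one] at hc
    have key : ∀ a : ZMod 8, a ^ 2 = 1 → ¬ (a ^ 2 = 7 ∨ a ^ 2 = 4 ∨ a ^ 2 = 0) := by decide
    refine key _ ?_ hc
    fin_cases i; simp_all
  · simp only [Fin.sum_univ_two] at hc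
    have key : ∀ a b : ZMod 8, (a ^ 2 = 1 ∨ b ^ 2 = 1) →
        ¬ (a ^ 2 + b ^ 2 = 7 ∨ a ^ 2 + b ^ 2 = 4 ∨ a ^ 2 + b ^ 2 = 0) := by decide
    refine key _ _ ?_ hc
    fin_cases i <;> simp_all
  · simp only [Fin.sum_univ_three] at hc
    have key : ∀ a b c : ZMod 8, (a ^ 2 = 1 ∨ b ^ 2 = 1 ∨ c ^ 2 = 1) →
        ¬ (a ^ 2 + b ^ 2 + c ^ 2 = 7 ∨ a ^ 2 + b ^ 2 + c ^ 2 = 4 ∨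
          a ^ 2 + b ^ 2 + c ^ 2 = 0) := by decide
    refine key _ _ _ ?_ hc
    fin_cases i <;> simp_all

lemma waring_two_adic_two :
    waring ℤ_[2] (2 ^ 1 * 1) = (4 : ℕ) ∧ waring ℚ_[2] (2 ^ 1 * 1) = (4 : ℕ) := by
  refine waring_padicInt_and_padic (N := 7) (by norm_num) (by norm_num)
    (PadicInt.exists_sum_pow_of_not_dvd (by norm_num) (by norm_num) ?_) (by norm_num) ?_
  · intro a ha
    obtain ⟨b, s, hs, hab, hdvd⟩ := PadicInt.exists_pow_add_natCast (k := 1) odd_one a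
    have h4 : ¬ 4 ∣ s + 1 := by
      rintro ⟨c, hc⟩
      apply ha
      have hc' : (s : ℤ_[2]) + 1 = 4 * c := by exact_mod_cast hc
      have h1 : (2 : ℤ_[2]) ^ (2 ^ 1 * 1) ∣ s + 1 := ⟨c, by rw [hc']; norm_num⟩
      simpa using dvd_add ((pow_dvd_pow 2 (by norm_num)).trans hdvd) h1
    rcases lt_or_ge s 4 with hs4 | hs4
    · exact ⟨s + 1, s.succ_pos, hs4, Fin.cons b fun _ => 1, by simp [Fin.sum_univ_succ, hab]⟩
    · obtain ⟨t, rfl⟩ := Nat.exists_eq_add_of_le hs4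
      refine ⟨t + 2, by omega, by omega, Fin.cons b (Fin.cons 2 fun _ => 1), ?_⟩
      rw [hab]
      simp [Fin.sum_univ_succ]
      norm_num
  · intro l j y ⟨i, hi⟩ hs
    have hsq : ∀ u : (ZMod 8)ˣ, (u : ZMod 8) ^ 2 = 1 := by decide
    let f : ℤ_[2] →+* ZMod 8 := PadicInt.toZModPow 3
    refine ZMod.four_le_of_primitive_sum_sq (j := j) (fun i => f (y i))
      ⟨i, hsq (hi.map f).unit⟩ ?_
    simpa [map_ofNat f 2, map_ofNat f 7] using congrArg f hs

/-- Let `k, d` be positive integers with `d` odd and `n = 2^k·d`. Then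
`w_n(ℤ_2) = w_n(ℚ_2)`, and the common value is `4` if `k = 1, d = 1`; `15` if
`k = 2, d = 1`; and `2^(k+2)` if `k > 2` or `d ≥ 3`. -/
theorem waring_two_adic (k d : ℕ) (hk : 0 < k) (hd : Odd d) :
    waring ℤ_[2] (2 ^ k * d) = waring ℚ_[2] (2 ^ k * d) ∧
      (k = 1 → d = 1 → waring ℤ_[2] (2 ^ k * d) = 4) ∧
      (k = 2 → d = 1 → waring ℤ_[2] (2 ^ k * d) = 15) ∧
      (2 < k ∨ 3 ≤ d → waring ℤ_[2] (2 ^ k * d) = 2 ^ (k + 2)) := by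
  have hd0 : 0 < d := hd.pos
  by_cases hgen : 2 < k ∨ 3 ≤ d
  · have hn : k + 2 < 2 ^ k * d := by
      have hlt : ∀ m : ℕ, m + 5 < 2 ^ (m + 3) := fun m => by
        induction m with
        | zero => norm_num
        | succ m ih => rw [show m + 1 + 3 = (m + 3) + 1 by ring, pow_succ]; omega
      rcases hgen with h | h
      · obtain ⟨m, rfl⟩ := Nat.exists_eq_add_of_le' h
        exact (hlt m).trans_le (Nat.le_mul_of_pos_right _ hd0)
      · have h1 : k < 2 ^ k := Nat.lt_two_pow_self
        nlinarith
    obtain ⟨h1, h2⟩ := waring_two_adic_generic hk hd hn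
    refine ⟨h1.trans h2.symm, ?_, ?_, fun _ => by simpa using h1⟩ <;> omega
  · obtain rfl : d = 1 := by
      obtain ⟨e, rfl⟩ := hd
      omega
    obtain rfl | rfl : k = 1 ∨ k = 2 := by omega
    · obtain ⟨h1, h2⟩ := waring_two_adic_two
      exact ⟨h1.trans h2.symm, fun _ _ => h1, by omega, by omega⟩
    · obtain ⟨h1, h2⟩ := waring_two_adic_four
      exact ⟨h1.trans h2.symm, by omega, fun _ _ => h1, by omega⟩
end
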